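/- arXiv:1904.06245 — 6 statements merged into one kernel-verified Lean document; each statement's English description precedes it below -/
import Mathlib

section
/- Let Q, Q_1, Q_2 be homogeneous quadratic polynomials in ℂ[x_1, …, x_n] such that Q vanishes at every point a ∈ ℂⁿ with Q_1(a) = Q_2(a) = 0. Then at least one of the following holds: (1) Q lies in the ℂ-linear span of Q_1 and Q_2; (2) there exist α, β ∈ ℂ, not both zero, and a linear form ℓ such that α·Q_1 + β·Q_2 = ℓ²; (3) there exist linear forms b_1 and b_2 such that each of Q, Q_1, Q_2 vanishes at every point a ∈ ℂⁿ with b_1(a) = b_2(a) = 0. -/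
open MvPolynomial

namespace QuadraticPencil

section Homogeneous

variable {σ R : Type*} [CommRing R]

/-- The algebra map sending `p` to `∑ pᵢ Tⁱ`, where `pᵢ` is the homogeneous component of `p` of
degree `i`. -/
noncomputable def homogenization (σ R : Type*) [CommRing R] :
    MvPolynomial σ R →ₐ[R] Polynomial (MvPolynomial σ R) :=
  aeval fun i => Polynomial.C (X i) * Polynomial.X

theorem homogenization_monomial (d : σ →₀ ℕ) (r : R) :
    homogenization σ R (monomial d r) = Polynomial.monomial d.degree (monomial d r) := by
  have h : Polynomial.C (monomial d r) =
      algebraMap R (Polynomial (MvPolynomial σ R)) r *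
        d.prod fun i k => Polynomial.C (X i : MvPolynomial σ R) ^ k := by
    rw [monomial_eq, Polynomial.C_mul, map_finsuppProd]
    simp only [map_pow]
    rfl
  rw [homogenization, aeval_monomial, ← Polynomial.C_mul_X_pow_eq_monomial, h, mul_assoc]
  congr 1
  simp only [mul_pow, Finsupp.prod, Finset.prod_mul_distrib, Finset.prod_pow_eq_pow_sum,
    Finsupp.degree_apply]

theorem coeff_homogenization (p : MvPolynomial σ R) (i : ℕ) :
    (homogenization σ R p).coeff i = homogeneousComponent i p := by
  induction p using MvPolynomial.induction_on' with
  | monomial d r =>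
    rw [homogenization_monomial, Polynomial.coeff_monomial]
    split_ifs with h
    · exact (homogeneousComponent_of_mem (h ▸ isHomogeneous_monomial r rfl)).symm ▸ by simp
    · rw [homogeneousComponent_of_mem (isHomogeneous_monomial r (rfl : d.degree = d.degree)),
        if_neg (Ne.symm h)]
  | add p q hp hq => rw [map_add, Polynomial.coeff_add, hp, hq, map_add]

theorem homogenization_of_isHomogeneous {p : MvPolynomial σ R} {m : ℕ} (hp : p.IsHomogeneous m) :
    homogenization σ R p = Polynomial.monomial m p := by
  ext1 i
  rw [coeff_homogenization, Polynomial.coeff_monomial, homogeneousComponent_of_mem hp]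
  simp only [eq_comm]

theorem homogenization_injective : Function.Injective (homogenization σ R) := by
  intro p q h
  ext d
  have := congrArg (fun f => coeff d (Polynomial.coeff f d.degree)) h
  simpa [coeff_homogenization, coeff_homogeneousComponent] using this

theorem exists_isHomogeneous_of_dvd {p q : MvPolynomial σ R} {m j : ℕ} (hp : p.IsHomogeneous m)
    (hq : q.IsHomogeneous (m + j)) (h : p ∣ q) : ∃ k, k.IsHomogeneous j ∧ q = p * k := by
  obtain ⟨k, rfl⟩ := h
  refine ⟨homogeneousComponent j k, homogeneousComponent_isHomogeneous j k, ?_⟩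
  have h := congrArg (fun f => Polynomial.coeff f (m + j)) (map_mul (homogenization σ R) p k)
  simp only [homogenization_of_isHomogeneous hp, homogenization_of_isHomogeneous hq,
    add_comm m j, Polynomial.coeff_monomial_mul, coeff_homogenization] at h
  simpa using h

theorem isHomogeneous_of_homogenization_natTrailingDegree_eq {p : MvPolynomial σ R}
    (h : (homogenization σ R p).natTrailingDegree = (homogenization σ R p).natDegree) :
    p.IsHomogeneous (homogenization σ R p).natDegree := by
  intro d hd
  have hne : (homogenization σ R p).coeff d.degree ≠ 0 := by
    intro h0
    rw [coeff_homogenization] at h0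
    have := congrArg (coeff d) h0
    rw [coeff_homogeneousComponent] at this
    simp_all
  have h1 := Polynomial.natTrailingDegree_le_of_ne_zero hne
  have h2 := Polynomial.le_natDegree_of_ne_zero hne
  have h3 : d.degree = (homogenization σ R p).natDegree := by omega
  rw [← h3, Finsupp.degree_eq_weight_one]
  rfl

theorem exists_isHomogeneous_of_mul [IsDomain R] {p q : MvPolynomial σ R} {N : ℕ}
    (h : (p * q).IsHomogeneous N) (h0 : p * q ≠ 0) :
    ∃ i j, i + j = N ∧ p.IsHomogeneous i ∧ q.IsHomogeneous j := by
  have hp : homogenization σ R p ≠ 0 := fun hp => left_ne_zero_of_mul h0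
    (homogenization_injective (hp.trans (map_zero _).symm))
  have hq : homogenization σ R q ≠ 0 := fun hq => right_ne_zero_of_mul h0
    (homogenization_injective (hq.trans (map_zero _).symm))
  have hm := (map_mul (homogenization σ R) p q).symm.trans (homogenization_of_isHomogeneous h)
  have hd := congrArg Polynomial.natDegree hm
  have ht := congrArg Polynomial.natTrailingDegree hm
  rw [Polynomial.natDegree_mul hp hq, Polynomial.natDegree_monomial_eq _ h0] at hd
  rw [Polynomial.natTrailingDegree_mul hp hq, Polynomial.natTrailingDegree_monomial h0] at ht
  have h1 := Polynomial.natTrailingDegree_le_natDegree (homogenization σ R p)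
  have h2 := Polynomial.natTrailingDegree_le_natDegree (homogenization σ R q)
  exact ⟨_, _, hd, isHomogeneous_of_homogenization_natTrailingDegree_eq (by omega),
    isHomogeneous_of_homogenization_natTrailingDegree_eq (by omega)⟩

theorem eq_C_of_isHomogeneous_zero {p : MvPolynomial σ R} (hp : p.IsHomogeneous 0) :
    ∃ c, p = C c :=
  ⟨_, totalDegree_eq_zero_iff_eq_C.1 (Nat.le_zero.1 hp.totalDegree_le)⟩

theorem eq_zero_of_dvd_of_lt [IsDomain R] {p q : MvPolynomial σ R} {m n : ℕ}
    (hp : p.IsHomogeneous m) (hq : q.IsHomogeneous n) (hlt : n < m) (h : p ∣ q) : q = 0 := by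
  obtain ⟨k, rfl⟩ := h
  by_contra h0
  have h1 := totalDegree_mul_of_isDomain (left_ne_zero_of_mul h0) (right_ne_zero_of_mul h0)
  rw [hq.totalDegree h0, hp.totalDegree (left_ne_zero_of_mul h0)] at h1
  omega

theorem eval_add_smul_of_isHomogeneous_one [Fintype σ] {L : MvPolynomial σ R}
    (hL : L.IsHomogeneous 1) (y v : σ → R) (t : R) :
    eval (y + t • v) L = eval y L + t * eval v L := by
  have hc : ∀ i, ∃ c, pderiv i L = C c := fun i => eq_C_of_isHomogeneous_zero hL.pderiv
  choose c hc using hc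
  have hE := hL.sum_X_mul_pderiv
  simp only [hc, one_smul] at hE
  rw [← hE]
  simp only [map_sum, map_mul, eval_X, eval_C, Pi.add_apply, Pi.smul_apply, smul_eq_mul,
    Finset.mul_sum, ← Finset.sum_add_distrib]
  exact Finset.sum_congr rfl fun i _ => by ring

end Homogeneous

section Field

variable {σ K : Type*} [Field K]

theorem exists_polar [Fintype σ] [NeZero (2 : K)] {F : MvPolynomial σ K} (hF : F.IsHomogeneous 2)
    (v : σ → K) :
    ∃ B : MvPolynomial σ K, B.IsHomogeneous 1 ∧
      ∀ y t, eval (y + t • v) F = eval y F + t * eval y B + t ^ 2 * eval v F := by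
  have h2 : (2 : K) ≠ 0 := NeZero.ne 2
  have hd : ∀ i, (pderiv i F).IsHomogeneous 1 := fun i => hF.pderiv
  have hE : ∀ y, eval y F = 2⁻¹ * ∑ i, y i * eval y (pderiv i F) := by
    intro y
    have h := congrArg (eval y) hF.sum_X_mul_pderiv
    simp only [map_sum, map_mul, eval_X, nsmul_eq_mul, Nat.cast_ofNat, map_ofNat] at h
    rw [h, inv_mul_cancel_left₀ h2]
  refine ⟨C 2⁻¹ * ∑ i, (C (eval v (pderiv i F)) * X i + C (v i) * pderiv i F),
    .C_mul (.sum _ _ _ fun i _ => ((isHomogeneous_X K i).C_mul _).add ((hd i).C_mul _)) _, ?_⟩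
  intro y t
  rw [hE, hE y, hE v]
  simp only [eval_add_smul_of_isHomogeneous_one (hd _), map_sum, map_mul, map_add, eval_X, eval_C,
    Pi.add_apply, Pi.smul_apply, smul_eq_mul, Finset.mul_sum, ← Finset.sum_add_distrib]
  exact Finset.sum_congr rfl fun i _ => by ring

theorem exists_eval_eq_one [Fintype σ] {L : MvPolynomial σ K} [Infinite K] (hL : L.IsHomogeneous 1)
    (h0 : L ≠ 0) : ∃ w, eval w L = 1 := by
  obtain ⟨w, hw⟩ : ∃ w, eval w L ≠ 0 := by
    by_contra! h
    exact h0 (funext fun w => by rw [h w, map_zero])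
  refine ⟨(0 : σ → K) + (eval w L)⁻¹ • w, ?_⟩
  have h00 : eval (0 : σ → K) L = 0 := by
    simpa using eval_add_smul_of_isHomogeneous_one hL (0 : σ → K) 0 1
  rw [eval_add_smul_of_isHomogeneous_one hL, h00, zero_add, inv_mul_cancel₀ hw]

theorem eval_sub_smul_self [Fintype σ] {L : MvPolynomial σ K} (hL : L.IsHomogeneous 1) {w : σ → K}
    (hw : eval w L = 1) (y : σ → K) : eval (y - eval y L • w) L = 0 := by
  rw [sub_eq_add_neg, ← neg_smul, eval_add_smul_of_isHomogeneous_one hL, hw]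
  ring

theorem exists_eval_sub_smul [Fintype σ] [NeZero (2 : K)] {L F : MvPolynomial σ K} (hL : L.IsHomogeneous 1)
    (hF : F.IsHomogeneous 2) (w : σ → K) :
    ∃ u : MvPolynomial σ K, u.IsHomogeneous 1 ∧
      ∀ y, eval (y - eval y L • w) F = eval y (F - L * u) := by
  obtain ⟨B, hB, h⟩ := exists_polar hF w
  refine ⟨B - C (eval w F) * L, hB.sub (hL.C_mul _), fun y => ?_⟩
  rw [sub_eq_add_neg, ← neg_smul, h]
  simp only [map_sub, map_mul, eval_C]
  ring

theorem prime_of_isHomogeneous_one {L : MvPolynomial σ K} (hL : L.IsHomogeneous 1) (h0 : L ≠ 0) :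
    Prime L := by
  refine Irreducible.prime (irreducible_of_totalDegree_eq_one (hL.totalDegree h0) fun c hc => ?_)
  refine isUnit_iff_ne_zero.2 fun hc0 => h0 ?_
  ext d
  simpa [hc0] using hc d

theorem isUnit_of_isHomogeneous_zero {p : MvPolynomial σ K} (hp : p.IsHomogeneous 0)
    (h0 : p ≠ 0) : IsUnit p := by
  obtain ⟨c, rfl⟩ := eq_C_of_isHomogeneous_zero hp
  exact (isUnit_iff_ne_zero.2 fun hc => h0 (by rw [hc, map_zero])).map C

theorem prime_of_isHomogeneous_two {q : MvPolynomial σ K} (hq : q.IsHomogeneous 2)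
    (h : ¬∃ s t : MvPolynomial σ K, s.IsHomogeneous 1 ∧ t.IsHomogeneous 1 ∧ q = s * t) :
    Prime q := by
  have h0 : q ≠ 0 := fun h0 =>
    h ⟨0, 0, isHomogeneous_zero _ _ _, isHomogeneous_zero _ _ _, by rw [h0, mul_zero]⟩
  refine Irreducible.prime ⟨fun hu => ?_, fun s t hst => ?_⟩
  · exact one_ne_zero (eq_zero_of_dvd_of_lt hq (isHomogeneous_one σ K) two_pos hu.dvd)
  · obtain ⟨i, j, hij, hs, ht⟩ := exists_isHomogeneous_of_mul (hst ▸ hq) (hst ▸ h0)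
    have hs0 : s ≠ 0 := left_ne_zero_of_mul (hst ▸ h0)
    have ht0 : t ≠ 0 := right_ne_zero_of_mul (hst ▸ h0)
    obtain rfl | rfl | rfl : i = 0 ∨ i = 1 ∨ j = 0 := by omega
    · exact .inl (isUnit_of_isHomogeneous_zero hs hs0)
    · obtain rfl : j = 1 := by omega
      exact absurd ⟨s, t, hs, ht, hst⟩ h
    · exact .inr (isUnit_of_isHomogeneous_zero ht ht0)

theorem exists_eq_mul_C_of_dvd {p q : MvPolynomial σ K} {m : ℕ} (hp : p.IsHomogeneous m)
    (hq : q.IsHomogeneous m) (h : p ∣ q) : ∃ c, q = p * C c := by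
  obtain ⟨k, hk, rfl⟩ := exists_isHomogeneous_of_dvd (j := 0) hp hq h
  obtain ⟨c, rfl⟩ := eq_C_of_isHomogeneous_zero hk
  exact ⟨c, rfl⟩

theorem dvd_of_forall_eval_eq_zero [Finite σ] [IsAlgClosed K] {P F : MvPolynomial σ K} (hP : Squarefree P)
    (h : ∀ a, eval a P = 0 → eval a F = 0) : P ∣ F := by
  have hF : F ∈ vanishingIdeal K (zeroLocus K (Ideal.span {P})) := by
    intro a ha
    exact h a (ha P (Ideal.mem_span_singleton_self P))
  rw [vanishingIdeal_zeroLocus_eq_radical] at hF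
  obtain ⟨k, hk⟩ := hF
  exact hP.isRadical k F (Ideal.mem_span_singleton.1 hk)

end Field

section Pencil

variable {n : ℕ}

/-- The three alternatives for quadratics `Q, Q1, Q2`: `Q` lies in the pencil of `Q1` and `Q2`,
or the pencil contains the square of a linear form, or all three vanish on the common zero set of
two linear forms. -/
def Trichotomy (Q Q1 Q2 : MvPolynomial (Fin n) ℂ) : Prop :=
  Q ∈ Submodule.span ℂ ({Q1, Q2} : Set (MvPolynomial (Fin n) ℂ)) ∨
    (∃ (α β : ℂ) (ℓ : MvPolynomial (Fin n) ℂ), (α ≠ 0 ∨ β ≠ 0) ∧ ℓ.IsHomogeneous 1 ∧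
      α • Q1 + β • Q2 = ℓ ^ 2) ∨
    (∃ b1 b2 : MvPolynomial (Fin n) ℂ, b1.IsHomogeneous 1 ∧ b2.IsHomogeneous 1 ∧
      ∀ a : Fin n → ℂ, eval a b1 = 0 → eval a b2 = 0 →
        eval a Q = 0 ∧ eval a Q1 = 0 ∧ eval a Q2 = 0)

variable {Q Q1 Q2 : MvPolynomial (Fin n) ℂ}

theorem Trichotomy.of_span (c1 c2 : ℂ) (h : Q = C c1 * Q1 + C c2 * Q2) : Trichotomy Q Q1 Q2 :=
  .inl (Submodule.mem_span_pair.2 ⟨c1, c2, by rw [h, smul_eq_C_mul, smul_eq_C_mul]⟩)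

theorem Trichotomy.of_sq (α β : ℂ) (h0 : α ≠ 0 ∨ β ≠ 0) {ℓ : MvPolynomial (Fin n) ℂ}
    (hℓ : ℓ.IsHomogeneous 1) (h : C α * Q1 + C β * Q2 = ℓ ^ 2) : Trichotomy Q Q1 Q2 :=
  .inr (.inl ⟨α, β, ℓ, h0, hℓ, by rw [← h, smul_eq_C_mul, smul_eq_C_mul]⟩)

theorem Trichotomy.of_vanishing
    (hvan : ∀ a : Fin n → ℂ, eval a Q1 = 0 → eval a Q2 = 0 → eval a Q = 0)
    {b1 b2 : MvPolynomial (Fin n) ℂ} (h1 : b1.IsHomogeneous 1) (h2 : b2.IsHomogeneous 1)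
    (h : ∀ a, eval a b1 = 0 → eval a b2 = 0 → eval a Q1 = 0 ∧ eval a Q2 = 0) :
    Trichotomy Q Q1 Q2 :=
  .inr (.inr ⟨b1, b2, h1, h2, fun a ha hb =>
    ⟨hvan a (h a ha hb).1 (h a ha hb).2, h a ha hb⟩⟩)

/-- The alternatives do not change when the pencil is reparametrized and `Q` is modified by an
element of the pencil. -/
theorem Trichotomy.of_sub {κ γ δ : ℂ} (hκ : κ ≠ 0)
    (h : Trichotomy (Q - C γ * Q1) (C κ * Q1) (Q2 - C δ * Q1)) : Trichotomy Q Q1 Q2 := by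
  rcases h with h | ⟨α, β, ℓ, h0, hℓ, h⟩ | ⟨b1, b2, h1, h2, h⟩
  · obtain ⟨c1, c2, h⟩ := Submodule.mem_span_pair.1 h
    refine .of_span (c1 * κ - c2 * δ + γ) c2 ?_
    rw [smul_eq_C_mul, smul_eq_C_mul] at h
    simp only [map_add, map_sub, map_mul]
    linear_combination -h
  · refine .of_sq (α * κ - β * δ) β ?_ hℓ ?_
    · by_contra! hc
      obtain ⟨hc, rfl⟩ := hc
      simp_all
    · rw [← h, smul_eq_C_mul, smul_eq_C_mul]
      simp only [map_sub, map_mul]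
      ring
  · refine .inr (.inr ⟨b1, b2, h1, h2, fun a ha hb => ?_⟩)
    obtain ⟨h3, h4, h5⟩ := h a ha hb
    simp only [map_sub, map_mul, eval_C, mul_eq_zero, hκ, false_or] at h3 h4 h5
    simp_all

theorem exists_eq_C_mul_or_eq_mul {q F : MvPolynomial (Fin n) ℂ} (hq : q.IsHomogeneous 2)
    (hF : F.IsHomogeneous 2) (h : ∀ a, eval a q = 0 → eval a F = 0) :
    (∃ s t : MvPolynomial (Fin n) ℂ, s.IsHomogeneous 1 ∧ t.IsHomogeneous 1 ∧ q = s * t) ∨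
      ∃ c, F = q * C c := by
  refine or_iff_not_imp_left.2 fun hr => ?_
  exact exists_eq_mul_C_of_dvd hq hF
    (dvd_of_forall_eval_eq_zero (prime_of_isHomogeneous_two hq hr).irreducible.squarefree h)

theorem exists_vanishing_or_dvd_of_hyperplane {l : MvPolynomial (Fin n) ℂ}
    (hl : l.IsHomogeneous 1) (hl0 : l ≠ 0) (hQ : Q.IsHomogeneous 2) (hQ1 : Q1.IsHomogeneous 2)
    (h : ∀ a, eval a l = 0 → eval a Q1 = 0 → eval a Q = 0) :
    (∃ s : MvPolynomial (Fin n) ℂ, s.IsHomogeneous 1 ∧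
      ∀ a, eval a l = 0 → eval a s = 0 → eval a Q1 = 0) ∨ ∃ c, l ∣ Q - C c * Q1 := by
  obtain ⟨w, hw⟩ := exists_eval_eq_one hl hl0
  obtain ⟨u1, hu1, h1⟩ := exists_eval_sub_smul hl hQ1 w
  obtain ⟨u, hu, h2⟩ := exists_eval_sub_smul hl hQ w
  rcases exists_eq_C_mul_or_eq_mul (hQ1.sub (hl.mul hu1)) (hQ.sub (hl.mul hu)) (fun a ha => by
    rw [← h2]
    exact h _ (eval_sub_smul_self hl hw a) (by rw [h1, ha])) with ⟨s, t, hs, -, hst⟩ | ⟨c, hc⟩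
  · refine .inl ⟨s, hs, fun a hla hsa => ?_⟩
    have := congrArg (eval a) hst
    simpa [hla, hsa] using this
  · exact .inr ⟨c, u - C c * u1, by linear_combination hc⟩

theorem trichotomy_of_eq_mul (hQ : Q.IsHomogeneous 2) (hQ1 : Q1.IsHomogeneous 2)
    (hvan : ∀ a : Fin n → ℂ, eval a Q1 = 0 → eval a Q2 = 0 → eval a Q = 0)
    {l m : MvPolynomial (Fin n) ℂ} (hl : l.IsHomogeneous 1) (hm : m.IsHomogeneous 1)
    (h : Q2 = l * m) : Trichotomy Q Q1 Q2 := by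
  subst h
  have hz : (l * m = 0) → Trichotomy Q Q1 (l * m) := fun h =>
    .of_sq 0 1 (.inr one_ne_zero) (isHomogeneous_zero _ _ 1) (by rw [h]; simp)
  by_cases hl0 : l = 0
  · exact hz (by rw [hl0, zero_mul])
  by_cases hm0 : m = 0
  · exact hz (by rw [hm0, mul_zero])
  rcases exists_vanishing_or_dvd_of_hyperplane hl hl0 hQ hQ1
    (fun a ha h1 => hvan a h1 (by rw [map_mul, ha, zero_mul])) with ⟨s, hs, h⟩ | ⟨c1, h1⟩
  · exact .of_vanishing hvan hl hs fun a ha hb => ⟨h a ha hb, by rw [map_mul, ha, zero_mul]⟩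
  rcases exists_vanishing_or_dvd_of_hyperplane hm hm0 hQ hQ1
    (fun a ha h1 => hvan a h1 (by rw [map_mul, ha, mul_zero])) with ⟨s, hs, h⟩ | ⟨c2, h2⟩
  · exact .of_vanishing hvan hm hs fun a ha hb => ⟨h a ha hb, by rw [map_mul, ha, mul_zero]⟩
  by_cases hc : c1 = c2
  · subst hc
    obtain ⟨k, hk, hlk⟩ := exists_isHomogeneous_of_dvd (j := 1) hl (hQ.sub (hQ1.C_mul _)) h1
    rcases (prime_of_isHomogeneous_one hm hm0).dvd_or_dvd (hlk ▸ h2) with hd | hd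
    · obtain ⟨c, rfl⟩ := exists_eq_mul_C_of_dvd hm hl hd
      obtain ⟨r, rfl⟩ := IsAlgClosed.exists_pow_nat_eq c two_pos
      exact .of_sq 0 1 (.inr one_ne_zero) (hm.C_mul r)
        (by simp only [map_zero, map_one, map_pow]; ring)
    · obtain ⟨c, rfl⟩ := exists_eq_mul_C_of_dvd hm hk hd
      exact .of_span c1 c (by linear_combination hlk)
  · refine .of_vanishing hvan hl hm fun a ha hb => ⟨?_, by rw [map_mul, ha, zero_mul]⟩
    obtain ⟨k1, h1⟩ := h1
    obtain ⟨k2, h2⟩ := h2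
    have e1 := congrArg (eval a) h1
    have e2 := congrArg (eval a) h2
    simp only [map_sub, map_mul, eval_C, ha, hb, zero_mul] at e1 e2
    have : (c1 - c2) * eval a Q1 = 0 := by linear_combination e2 - e1
    exact (mul_eq_zero.1 this).resolve_left (sub_ne_zero.2 hc)

variable {x b e a d f : MvPolynomial (Fin n) ℂ}

theorem trichotomy_of_linear_dvd_resultant (hx : x.IsHomogeneous 1) (hb : b.IsHomogeneous 1)
    (ha : a.IsHomogeneous 2) (hb0 : b ≠ 0) (hba : ¬b ∣ a)
    (hvan : ∀ y : Fin n → ℂ, eval y (x ^ 2 - d) = 0 → eval y (x * b - a) = 0 → eval y Q = 0)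
    {p : MvPolynomial (Fin n) ℂ} (hp : p.IsHomogeneous 1) (hp0 : p ≠ 0)
    (hdvd : p ∣ a ^ 2 - d * b ^ 2) : Trichotomy Q (x ^ 2 - d) (x * b - a) := by
  have hpp := prime_of_isHomogeneous_one hp hp0
  have hpb : ¬p ∣ b := by
    intro h
    have hpa : p ∣ a := hpp.dvd_of_dvd_pow
      ((dvd_sub_left ((h.trans (dvd_pow_self b two_ne_zero)).mul_left d)).1 hdvd)
    obtain ⟨c, rfl⟩ := exists_eq_mul_C_of_dvd hp hb h
    have hc : c ≠ 0 := by
      rintro rfl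
      simp at hb0
    exact hba (((isUnit_iff_ne_zero.2 hc).map C).mul_right_dvd.2 hpa)
  obtain ⟨z, hpz, hbz⟩ : ∃ z, eval z p = 0 ∧ eval z b ≠ 0 := by
    by_contra! h
    exact hpb (dvd_of_forall_eval_eq_zero hpp.irreducible.squarefree h)
  obtain ⟨w, hpw, hbw⟩ : ∃ w, eval w p = 0 ∧ eval w b = 1 := by
    have h0 : ∀ {L : MvPolynomial (Fin n) ℂ}, L.IsHomogeneous 1 →
        eval (0 : Fin n → ℂ) L = 0 := fun hL => by
      simpa using eval_add_smul_of_isHomogeneous_one hL (0 : Fin n → ℂ) 0 1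
    refine ⟨0 + (eval z b)⁻¹ • z, ?_, ?_⟩
    · rw [eval_add_smul_of_isHomogeneous_one hp, h0 hp, hpz]
      ring
    · rw [eval_add_smul_of_isHomogeneous_one hb, h0 hb, zero_add, inv_mul_cancel₀ hbz]
  obtain ⟨u, hu, h⟩ := exists_eval_sub_smul hb ha w
  obtain ⟨k, hk⟩ : p ∣ a - b * u := by
    refine dvd_of_forall_eval_eq_zero hpp.irreducible.squarefree fun y hy => ?_
    rw [← h]
    have h1 := eval_sub_smul_self hb hbw y
    have h2 : eval (y - eval y b • w) p = 0 := by
      rw [sub_eq_add_neg, ← neg_smul, eval_add_smul_of_isHomogeneous_one hp, hy, hpw]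
      ring
    obtain ⟨k, hk⟩ := hdvd
    have h3 := congrArg (eval (y - eval y b • w)) hk
    simpa [h1, h2] using h3
  have hud : p ∣ u ^ 2 - d := by
    have h1 : p ∣ b ^ 2 * (u ^ 2 - d) := by
      obtain ⟨j, hj⟩ := hdvd
      exact ⟨j - k * (a + b * u), by linear_combination hj - (a + b * u) * hk⟩
    exact (hpp.dvd_or_dvd h1).resolve_left fun h => hpb (hpp.dvd_of_dvd_pow h)
  refine .of_vanishing hvan hp (hx.sub hu) fun y h1 h2 => ?_
  obtain ⟨j, hj⟩ := hud
  have e1 := congrArg (eval y) hj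
  have e2 := congrArg (eval y) hk
  simp only [map_sub, map_mul, map_pow, h1, zero_mul] at e1 e2 h2 ⊢
  rw [sub_eq_zero.1 h2]
  exact ⟨e1, by linear_combination -e2⟩

theorem trichotomy_of_sq_dvd_sub (hx : x.IsHomogeneous 1) (hb : b.IsHomogeneous 1)
    (ha : a.IsHomogeneous 2) (hb0 : b ≠ 0) {r : MvPolynomial (Fin n) ℂ} (hr : r.IsHomogeneous 2)
    (h : a ^ 2 - d * b ^ 2 = r ^ 2) (hdvd : b ^ 2 ∣ a - r) :
    Trichotomy Q (x ^ 2 - d) (x * b - a) := by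
  obtain ⟨c, hc⟩ := exists_eq_mul_C_of_dvd (hb.pow 2) (ha.sub hr) hdvd
  have hd : d = C c * (a + r) :=
    mul_left_cancel₀ (pow_ne_zero 2 hb0) (by linear_combination (a + r) * hc - h)
  refine .of_sq 1 (-2 * c) (.inl one_ne_zero) (hx.sub (hb.C_mul c)) ?_
  simp only [map_mul, map_neg, map_one, map_ofNat]
  linear_combination -hd + C c * hc

theorem trichotomy_of_resultant_eq_sq (hx : x.IsHomogeneous 1) (hb : b.IsHomogeneous 1)
    (ha : a.IsHomogeneous 2) (hb0 : b ≠ 0) (hba : ¬b ∣ a)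
    {r : MvPolynomial (Fin n) ℂ} (hr : r.IsHomogeneous 2)
    (h : a ^ 2 - d * b ^ 2 = r ^ 2) : Trichotomy Q (x ^ 2 - d) (x * b - a) := by
  have hbp := prime_of_isHomogeneous_one hb hb0
  have hmul : b ^ 2 ∣ (a - r) * (a - -r) := ⟨d, by linear_combination h⟩
  by_cases h1 : b ∣ a - r
  · by_cases h2 : b ∣ a - -r
    · have h3 : b ∣ C 2 * a := by
        convert dvd_add h1 h2 using 1
        rw [map_ofNat]
        ring
      exact absurd (((isUnit_iff_ne_zero.2 two_ne_zero).map C).dvd_mul_left.1 h3) hba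
    · exact trichotomy_of_sq_dvd_sub hx hb ha hb0 hr h (hbp.pow_dvd_of_dvd_mul_right 2 h2 hmul)
  · exact trichotomy_of_sq_dvd_sub hx hb ha hb0 hr.neg (by rw [h, neg_sq])
      (hbp.pow_dvd_of_dvd_mul_left 2 h1 hmul)

theorem trichotomy_of_eliminated_eq_zero (hx : x.IsHomogeneous 1) (he : e.IsHomogeneous 1)
    (ha : a.IsHomogeneous 2) (hd : d.IsHomogeneous 2) (hf : f.IsHomogeneous 2) (hap : Prime a)
    (H : ∀ (y : Fin n → ℂ) (s : ℂ), s ^ 2 = eval y d → eval y a = 0 →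
      s * eval y e + eval y f = 0) : Trichotomy (x * e + f) (x ^ 2 - d) (-a) := by
  have hef : ∀ y, eval y a = 0 → eval y f = 0 ∧ eval y (e * d) = 0 := by
    intro y hy
    obtain ⟨s, hs⟩ := IsAlgClosed.exists_pow_nat_eq (eval y d) two_pos
    have h1 := H y s hs hy
    have h2 := H y (-s) (by rw [neg_sq, hs]) hy
    refine ⟨by linear_combination (h1 + h2) / 2, ?_⟩
    rw [map_mul, ← hs]
    linear_combination s * (h1 - h2) / 2
  obtain ⟨c, rfl⟩ := exists_eq_mul_C_of_dvd ha hf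
    (dvd_of_forall_eval_eq_zero hap.irreducible.squarefree fun y hy => (hef y hy).1)
  rcases hap.dvd_or_dvd (dvd_of_forall_eval_eq_zero hap.irreducible.squarefree
    fun y hy => (hef y hy).2) with h | h
  · rw [eq_zero_of_dvd_of_lt ha he one_lt_two h]
    exact .of_span 0 (-c) (by simp only [map_zero, map_neg]; ring)
  · obtain ⟨k, rfl⟩ := exists_eq_mul_C_of_dvd ha hd h
    exact .of_sq 1 (-k) (.inl one_ne_zero) hx (by simp only [map_one, map_neg]; ring)

/-- The structure theorem in normal form. On the line through `y` in a direction `v` along which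
`x` has slope one and `a`, `b`, `d`, `e`, `f` are constant, the three quadratics take the values
`s ^ 2 - d`, `s * b - a` and `s * e + f`. -/
theorem trichotomy_of_normal_form (hx : x.IsHomogeneous 1) (hb : b.IsHomogeneous 1)
    (he : e.IsHomogeneous 1) (ha : a.IsHomogeneous 2) (hd : d.IsHomogeneous 2)
    (hf : f.IsHomogeneous 2)
    (H : ∀ (y : Fin n → ℂ) (s : ℂ), s ^ 2 = eval y d → s * eval y b = eval y a →
      s * eval y e + eval y f = 0) :
    Trichotomy (x * e + f) (x ^ 2 - d) (x * b - a) := by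
  have hvan : ∀ y : Fin n → ℂ, eval y (x ^ 2 - d) = 0 → eval y (x * b - a) = 0 →
      eval y (x * e + f) = 0 := by
    intro y h1 h2
    simp only [map_sub, map_mul, map_pow, map_add, sub_eq_zero] at h1 h2 ⊢
    exact H y _ h1 h2
  by_cases hred : ∃ l m : MvPolynomial (Fin n) ℂ,
      l.IsHomogeneous 1 ∧ m.IsHomogeneous 1 ∧ x * b - a = l * m
  · obtain ⟨l, m, hl, hm, hlm⟩ := hred
    exact trichotomy_of_eq_mul ((hx.mul he).add hf) ((hx.pow 2).sub hd) hvan hl hm hlm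
  by_cases hb0 : b = 0
  · subst hb0
    rw [mul_zero, zero_sub] at hred ⊢
    refine trichotomy_of_eliminated_eq_zero hx he ha hd hf
      (prime_of_isHomogeneous_two ha ?_) fun y s hs hy => H y s hs (by rw [hy, map_zero, mul_zero])
    rintro ⟨l, m, hl, hm, rfl⟩
    exact hred ⟨-l, m, hl.neg, hm, by ring⟩
  have hbp := prime_of_isHomogeneous_one hb hb0
  have hba : ¬b ∣ a := by
    intro h
    obtain ⟨k, hk, rfl⟩ := exists_isHomogeneous_of_dvd (j := 1) hb ha h
    exact hred ⟨b, x - k, hb, hx.sub hk, by ring⟩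
  have hP : (a ^ 2 - d * b ^ 2).IsHomogeneous 4 := (ha.pow 2).sub (hd.mul (hb.pow 2))
  have hP0 : a ^ 2 - d * b ^ 2 ≠ 0 := fun h =>
    hba (hbp.dvd_of_dvd_pow (n := 2) ⟨d * b, by linear_combination h⟩)
  by_cases hsq : Squarefree (a ^ 2 - d * b ^ 2)
  · have hG : (e * a + f * b).IsHomogeneous 3 := (he.mul ha).add (hf.mul hb)
    have hG0 : e * a + f * b = 0 := by
      refine eq_zero_of_dvd_of_lt hP hG (by norm_num)
        (dvd_of_forall_eval_eq_zero hsq fun y hy => ?_)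
      simp only [map_sub, map_mul, map_pow, map_add] at hy ⊢
      by_cases hby : eval y b = 0
      · have hay : eval y a = 0 := by simpa [hby] using hy
        rw [hby, hay]
        ring
      · have h1 := H y (eval y a / eval y b)
          (by field_simp; linear_combination hy) (by field_simp)
        field_simp at h1
        linear_combination h1
    obtain ⟨c, rfl⟩ := exists_eq_mul_C_of_dvd hb he
      ((hbp.dvd_or_dvd ⟨-f, by linear_combination hG0⟩).resolve_right hba)
    have hf' : C c * a + f = 0 := mul_left_cancel₀ hb0 (by linear_combination hG0)
    exact .of_span 0 c (by rw [map_zero]; linear_combination hf')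
  · simp only [Squarefree, not_forall] at hsq
    obtain ⟨p, ⟨k, hk⟩, hpu⟩ := hsq
    rw [mul_assoc] at hk
    obtain ⟨i, j, hij, hp, hpk⟩ := exists_isHomogeneous_of_mul (hk ▸ hP) (hk ▸ hP0)
    have hpk0 : p * k ≠ 0 := right_ne_zero_of_mul (hk ▸ hP0)
    have hp0 : p ≠ 0 := left_ne_zero_of_mul hpk0
    obtain ⟨i', j', hij', hp', hk'⟩ := exists_isHomogeneous_of_mul hpk hpk0
    obtain rfl := hp.inj_right hp' hp0
    obtain rfl | rfl | ⟨rfl, rfl⟩ : i = 0 ∨ i = 1 ∨ i = 2 ∧ j' = 0 := by omega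
    · exact absurd (isUnit_of_isHomogeneous_zero hp hp0) hpu
    · exact trichotomy_of_linear_dvd_resultant hx hb ha hb0 hba hvan hp hp0 ⟨_, hk⟩
    · obtain ⟨c, rfl⟩ := eq_C_of_isHomogeneous_zero hk'
      obtain ⟨r, rfl⟩ := IsAlgClosed.exists_pow_nat_eq c two_pos
      exact trichotomy_of_resultant_eq_sq hx hb ha hb0 hba (hp.C_mul r)
        (by rw [hk, map_pow]; ring)

end Pencil

end QuadraticPencil

open QuadraticPencil

/-- **Structure theorem for quadratics with `Q ∈ √(Q₁, Q₂)`.**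
If homogeneous quadratics `Q, Q1, Q2 ∈ ℂ[x_1, …, x_n]` satisfy that `Q` vanishes whenever
`Q1` and `Q2` vanish, then either `Q ∈ span{Q1, Q2}`, or some nontrivial linear
combination `α Q1 + β Q2` is the square of a linear form, or there are two linear forms
`b1, b2` such that `Q, Q1, Q2` all vanish on the common zero set of `b1, b2`. -/
theorem stmt_3 (n : ℕ) (Q Q1 Q2 : MvPolynomial (Fin n) ℂ)
    (hQ : Q.IsHomogeneous 2) (hQ1 : Q1.IsHomogeneous 2) (hQ2 : Q2.IsHomogeneous 2)
    (hvan : ∀ a : Fin n → ℂ, eval a Q1 = 0 → eval a Q2 = 0 → eval a Q = 0) :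
    Q ∈ Submodule.span ℂ ({Q1, Q2} : Set (MvPolynomial (Fin n) ℂ)) ∨
    (∃ (α β : ℂ) (ℓ : MvPolynomial (Fin n) ℂ), (α ≠ 0 ∨ β ≠ 0) ∧ ℓ.IsHomogeneous 1 ∧
      α • Q1 + β • Q2 = ℓ ^ 2) ∨
    (∃ b1 b2 : MvPolynomial (Fin n) ℂ, b1.IsHomogeneous 1 ∧ b2.IsHomogeneous 1 ∧
      ∀ a : Fin n → ℂ, eval a b1 = 0 → eval a b2 = 0 →
        eval a Q = 0 ∧ eval a Q1 = 0 ∧ eval a Q2 = 0) := by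
  change Trichotomy Q Q1 Q2
  by_cases h0 : Q1 = 0
  · exact .of_sq 1 0 (.inl one_ne_zero) (isHomogeneous_zero _ _ 1) (by rw [h0]; simp)
  obtain ⟨v, hv⟩ : ∃ v, eval v Q1 ≠ 0 := by
    by_contra! h
    exact h0 (funext fun w => by rw [h w, map_zero])
  set κ := (eval v Q1)⁻¹
  have hκ0 : κ ≠ 0 := inv_ne_zero hv
  obtain ⟨B1, hB1, h1⟩ := exists_polar hQ1 v
  obtain ⟨B2, hB2, h2⟩ := exists_polar (hQ2.sub (hQ1.C_mul (eval v Q2 * κ))) v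
  obtain ⟨B, hB, h⟩ := exists_polar (hQ.sub (hQ1.C_mul (eval v Q * κ))) v
  have hκv : κ * eval v Q1 = 1 := inv_mul_cancel₀ hv
  set x : MvPolynomial (Fin n) ℂ := C (κ / 2) * B1 with hxdef
  have hx : x.IsHomogeneous 1 := hB1.C_mul _
  have key := trichotomy_of_normal_form hx hB2 hB
    (a := x * B2 - (Q2 - C (eval v Q2 * κ) * Q1)) (d := x ^ 2 - C κ * Q1)
    (f := (Q - C (eval v Q * κ) * Q1) - x * B)
    ((hx.mul hB2).sub (hQ2.sub (hQ1.C_mul _))) ((hx.pow 2).sub (hQ1.C_mul _))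
    ((hQ.sub (hQ1.C_mul _)).sub (hx.mul hB)) (fun y s hs hsb => ?_)
  · rw [sub_sub_cancel, sub_sub_cancel, add_sub_cancel] at key
    exact key.of_sub hκ0
  have e1 := h1 y (s - eval y x)
  have e2 := h2 y (s - eval y x)
  have e := h y (s - eval y x)
  have hxe : eval y x = κ / 2 * eval y B1 := by rw [hxdef, map_mul, eval_C]
  simp only [map_sub, map_mul, map_pow, eval_C] at e2 e hs hsb ⊢
  have z1 : eval (y + (s - eval y x) • v) Q1 = 0 := by
    refine (mul_eq_zero.1 (?_ : κ * _ = 0)).resolve_left hκ0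
    rw [e1]
    linear_combination (s - eval y x) ^ 2 * hκv + hs - 2 * (s - eval y x) * hxe
  have z2 : eval (y + (s - eval y x) • v) Q2 = 0 := by
    rw [z1] at e2
    linear_combination e2 + hsb - (s - eval y x) ^ 2 * eval v Q2 * hκv
  have z := hvan _ z1 z2
  rw [z1, z] at e
  linear_combination -e + (s - eval y x) ^ 2 * eval v Q * hκv
end

section
/- Let 0 < δ < 1 and let v_0, v_1, …, v_m be distinct points in ℂ^d with the property that for every i ∈ {1, …, m} there are at least δ·m indices j ∈ {1, …, m} with j ≠ i such that the (affine) line through v_i and v_j contains a point v_k of the set {v_0, v_1, …, v_m} with k ∉ {i, j}. Then the ℂ-linear span of {v_0, v_1, …, v_m} has dimension less than 50/δ. -/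
open scoped Classical

/-- A greedy basis: if no subspace `U` contains more than a `dim U / dim X` fraction of the vectors
`x i`, some basis extracted from `x` has at least the average weight. -/
theorem exists_linearIndepOn_weight_le {K X ι : Type*} [Field K] [AddCommGroup X] [Module K X]
    [FiniteDimensional K X] [Fintype ι] (x : ι → X)
    (hx : ∀ U : Submodule K X, Module.finrank K X * (Finset.univ.filter fun i => x i ∈ U).card ≤
      Fintype.card ι * Module.finrank K U) (hcard : 0 < Fintype.card ι) (t : ι → ℝ) :
    ∃ S : Finset ι, LinearIndepOn K x S ∧ S.card = Module.finrank K X ∧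
      Module.finrank K X * ∑ i, t i ≤ Fintype.card ι * ∑ i ∈ S, t i := by
  have key : ∀ s : Finset ι, ∃ S : Finset ι, S ⊆ s ∧ LinearIndepOn K x S ∧
      (∀ i ∈ s, x i ∈ Submodule.span K (x '' S)) ∧
      ∀ c : ℝ, (∀ i ∈ s, c ≤ t i) →
        Module.finrank K X * ∑ i ∈ s, (t i - c) ≤ Fintype.card ι * ∑ i ∈ S, (t i - c) := by
    intro s
    induction s using Finset.induction_on_min_value t with
    | empty => exact ⟨∅, by simp⟩
    | insert a s ha hmin ih =>
      obtain ⟨S, hSs, hS, hspan, hsum⟩ := ih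
      have haS : a ∉ S := fun h => ha (hSs h)
      obtain ⟨S', hS's, hS', hspan', hsum'⟩ : ∃ S' : Finset ι, S' ⊆ insert a s ∧
          LinearIndepOn K x S' ∧ (∀ i ∈ insert a s, x i ∈ Submodule.span K (x '' S')) ∧
          ∑ i ∈ S', (t i - t a) = ∑ i ∈ S, (t i - t a) := by
        by_cases h : x a ∈ Submodule.span K (x '' S)
        · refine ⟨S, hSs.trans (Finset.subset_insert _ _), hS, ?_, rfl⟩
          intro i hi
          rcases Finset.mem_insert.1 hi with rfl | hi
          exacts [h, hspan i hi]
        · refine ⟨insert a S, Finset.insert_subset_insert _ hSs, ?_, ?_, ?_⟩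
          · rw [Finset.coe_insert]
            exact hS.insert h
          · intro i hi
            rcases Finset.mem_insert.1 hi with rfl | hi
            · exact Submodule.subset_span ⟨i, by simp⟩
            · refine Submodule.span_mono (Set.image_mono ?_) (hspan i hi)
              simp
          · rw [Finset.sum_insert haS]
            simp
      refine ⟨S', hS's, hS', hspan', fun c hc => ?_⟩
      have hfin : Module.finrank K (Submodule.span K (x '' S')) = S'.card := by
        have h := finrank_span_eq_card (R := K) hS'
        rw [← Set.image_eq_range] at h
        simpa using h
      have hcount : (Module.finrank K X : ℝ) * (insert a s).card ≤
          Fintype.card ι * S'.card := by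
        have h1 := hx (Submodule.span K (x '' S'))
        rw [hfin] at h1
        have h2 : (insert a s).card ≤
            (Finset.univ.filter fun i => x i ∈ Submodule.span K (x '' S')).card :=
          Finset.card_le_card fun i hi => by simpa using hspan' i hi
        exact_mod_cast (Nat.mul_le_mul_left _ h2).trans h1
      have hshift : ∀ u : Finset ι, ∑ i ∈ u, (t i - c) =
          ∑ i ∈ u, (t i - t a) + u.card * (t a - c) := by
        intro u
        simp only [Finset.sum_sub_distrib, Finset.sum_const, nsmul_eq_mul]
        ring
      have hca : 0 ≤ t a - c := sub_nonneg.2 (hc a (by simp))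
      have h3 := hsum (t a) hmin
      rw [hshift, hshift S', hsum', Finset.sum_insert ha]
      nlinarith [mul_le_mul_of_nonneg_right hcount hca]
  obtain ⟨S, -, hS, hspan, hsum⟩ := key Finset.univ
  have hfin : Module.finrank K (Submodule.span K (x '' S)) = S.card := by
    have h := finrank_span_eq_card (R := K) hS
    rw [← Set.image_eq_range] at h
    simpa using h
  have hSle : S.card ≤ Module.finrank K X := hfin ▸ Submodule.finrank_le _
  have hSc : S.card = Module.finrank K X := by
    refine le_antisymm hSle ?_
    have h1 := hx (Submodule.span K (x '' S))
    rw [hfin, Finset.filter_true_of_mem (fun i _ => hspan i (Finset.mem_univ i)),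
      Finset.card_univ, mul_comm] at h1
    exact Nat.le_of_mul_le_mul_left h1 hcard
  refine ⟨S, hS, hSc, ?_⟩
  obtain ⟨c, hc⟩ := (Set.finite_range t).bddBelow
  have h := hsum c fun i _ => hc ⟨i, rfl⟩
  simp only [Finset.sum_sub_distrib, Finset.sum_const, nsmul_eq_mul, hSc, Finset.card_univ] at h
  linarith

open Matrix in
/-- The frame matrix `∑ i, w i • x i (x i)ᴴ` of a weighted family of vectors. -/
noncomputable def frameMatrix {ι κ : Type*} (s : Finset ι) (x : ι → κ → ℂ) (w : ι → ℝ) :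
    Matrix κ κ ℂ :=
  ∑ i ∈ s, (w i : ℂ) • vecMulVec (x i) (star (x i))

section frameMatrix

open Matrix
open scoped ComplexOrder

variable {ι κ : Type*} [Fintype κ] (x : ι → κ → ℂ) (w : ι → ℝ)

theorem det_add_smul_vecMulVec_star [DecidableEq κ] {A : Matrix κ κ ℂ} (hA : IsUnit A.det)
    (c : ℂ) (u : κ → ℂ) :
    (A + c • vecMulVec u (star u)).det = A.det * (1 + c * (star u ⬝ᵥ A⁻¹ *ᵥ u)) := by
  have h := det_add_replicateCol_mul_replicateRow (ι := Unit) hA (c • u) (star u)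
  have h2 : replicateCol Unit (c • u) * replicateRow Unit (star u) =
      c • vecMulVec u (star u) := by
    rw [← vecMulVec_eq, smul_vecMulVec]
  rw [h2] at h
  rw [h]
  congr 2
  simp [Matrix.mul_apply, dotProduct, mulVec, replicateRow, replicateCol, Finset.sum_mul,
    Finset.mul_sum]
  rw [Finset.sum_comm]
  refine Finset.sum_congr rfl fun i _ => Finset.sum_congr rfl fun j _ => by ring

theorem posSemidef_frameMatrix (s : Finset ι) (hw : ∀ i, 0 ≤ w i) :
    (frameMatrix s x w).PosSemidef := by
  refine posSemidef_sum _ fun i _ => ?_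
  exact (posSemidef_vecMulVec_self_star (x i)).smul (by exact_mod_cast hw i)

theorem norm_det_le_norm_det_add_frameMatrix [DecidableEq κ] {A : Matrix κ κ ℂ}
    (hA : A.PosDef) (s : Finset ι) (hw : ∀ i, 0 ≤ w i) : ‖A.det‖ ≤ ‖(A + frameMatrix s x w).det‖ := by
  induction s using Finset.induction_on with
  | empty => simp [frameMatrix]
  | insert a s ha ih =>
    have hB : (A + frameMatrix s x w).PosDef := hA.add_posSemidef (posSemidef_frameMatrix x w s hw)
    have h1 : A + frameMatrix (insert a s) x w =
        (A + frameMatrix s x w) + (w a : ℂ) • vecMulVec (x a) (star (x a)) := by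
      rw [frameMatrix, Finset.sum_insert ha, frameMatrix]
      abel
    rw [h1, det_add_smul_vecMulVec_star ((isUnit_iff_isUnit_det _).1 hB.isUnit), norm_mul]
    refine ih.trans (le_mul_of_one_le_right (norm_nonneg _) ?_)
    have h2 : 0 ≤ (w a : ℂ) * (star (x a) ⬝ᵥ (A + frameMatrix s x w)⁻¹ *ᵥ x a) :=
      mul_nonneg (by exact_mod_cast hw a) (hB.inv.posSemidef.dotProduct_mulVec_nonneg _)
    calc (1 : ℝ) ≤ (1 + (w a : ℂ) * (star (x a) ⬝ᵥ (A + frameMatrix s x w)⁻¹ *ᵥ x a)).re := by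
          simpa using (Complex.le_def.1 h2).1
      _ ≤ _ := Complex.re_le_norm _

theorem frameMatrix_eq_mul [DecidableEq κ] (s : Finset ι) {e : κ ≃ s} :
    frameMatrix s x w = (of fun k l => x (e l) k) * diagonal (fun l => (w (e l) : ℂ)) *
      (of fun k l => x (e l) k)ᴴ := by
  ext k l
  rw [Matrix.mul_apply, frameMatrix, Matrix.sum_apply, ← Finset.sum_coe_sort, ← e.sum_comp]
  refine Finset.sum_congr rfl fun i _ => ?_
  simp only [Matrix.smul_apply, vecMulVec_apply, mul_diagonal, conjTranspose_apply, of_apply,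
    Pi.star_apply, smul_eq_mul]
  ring

theorem norm_det_frameMatrix_basis [DecidableEq κ] (s : Finset ι) (hs : LinearIndepOn ℂ x s)
    (hc : s.card = Fintype.card κ) :
    ∃ c : ℝ, 0 < c ∧ ∀ w : ι → ℝ, (∀ i, 0 < w i) →
      (frameMatrix s x w).PosDef ∧ ‖(frameMatrix s x w).det‖ = c * ∏ i ∈ s, w i := by
  let e : κ ≃ s := Fintype.equivOfCardEq (by simp [hc])
  let Y : Matrix κ κ ℂ := of fun k l => x (e l) k
  have hY : IsUnit Y.det := by
    rw [← isUnit_iff_isUnit_det, ← linearIndependent_cols_iff_isUnit]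
    exact hs.comp e e.injective
  refine ⟨‖Y.det‖ ^ 2, by have := norm_pos_iff.2 hY.ne_zero; positivity, fun w hw => ?_⟩
  have hdet : ‖(frameMatrix s x w).det‖ = ‖Y.det‖ ^ 2 * ∏ i ∈ s, w i := by
    rw [frameMatrix_eq_mul x w s (e := e)]
    change ‖(Y * _ * Yᴴ).det‖ = _
    rw [det_mul, det_mul, det_diagonal, det_conjTranspose, norm_mul, norm_mul, norm_star,
      norm_prod]
    have h : ∏ i, ‖(w (e i) : ℂ)‖ = ∏ i ∈ s, w i := by
      rw [e.prod_comp (fun i => ‖(w i : ℂ)‖), Finset.prod_coe_sort s (fun i => ‖(w i : ℂ)‖)]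
      exact Finset.prod_congr rfl fun i _ => by
        rw [Complex.norm_real, Real.norm_of_nonneg (hw i).le]
    rw [h]
    ring
  refine ⟨?_, hdet⟩
  rw [(posSemidef_frameMatrix x w s fun i => (hw i).le).posDef_iff_isUnit,
    isUnit_iff_isUnit_det, isUnit_iff_ne_zero, ← norm_pos_iff, hdet]
  have := norm_pos_iff.2 hY.ne_zero
  have := Finset.prod_pos fun i (_ : i ∈ s) => hw i
  positivity

end frameMatrix

section balancing

open Matrix
open scoped ComplexOrder

variable {ι κ : Type*} [Fintype ι]

theorem frameMatrix_update (x : ι → κ → ℂ) (w : ι → ℝ) (i : ι) (c : ℝ) :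
    frameMatrix Finset.univ x (Function.update w i (c * w i)) = frameMatrix Finset.univ x w +
      (((c - 1) * w i : ℝ) : ℂ) • vecMulVec (x i) (star (x i)) := by
  have h : ∀ j, ((Function.update w i (c * w i) j : ℝ) : ℂ) • vecMulVec (x j) (star (x j)) =
      (w j : ℂ) • vecMulVec (x j) (star (x j)) +
        if j = i then (((c - 1) * w i : ℝ) : ℂ) • vecMulVec (x i) (star (x i)) else 0 := by
    intro j
    by_cases hj : j = i
    · subst hj
      rw [Function.update_self, if_pos rfl, ← add_smul]
      congr 1
      push_cast
      ring
    · rw [Function.update_of_ne hj, if_neg hj, add_zero]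
  simp only [frameMatrix, h, Finset.sum_add_distrib, Finset.sum_ite_eq', Finset.mem_univ, if_true]

/-- Near a minimiser of `log det (frameMatrix w) - (dim / card) ∑ log w`, all leverage scores are
close to their average. -/
theorem exists_weight_leverage_near [Fintype κ] [DecidableEq κ] (x : ι → κ → ℂ)
    (hx : ∀ U : Submodule ℂ (κ → ℂ), Fintype.card κ * (Finset.univ.filter fun i => x i ∈ U).card ≤
      Fintype.card ι * Module.finrank ℂ U) (hι : 0 < Fintype.card ι) (hκ : 0 < Fintype.card κ) :
    ∃ w : ι → ℝ, (∀ i, 0 < w i) ∧ (frameMatrix Finset.univ x w).PosDef ∧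
      ∀ i, ∃ l : ℝ, (w i : ℂ) * (star (x i) ⬝ᵥ (frameMatrix Finset.univ x w)⁻¹ *ᵥ x i) = l ∧
        99 / 100 * (Fintype.card κ / Fintype.card ι : ℝ) ≤ l ∧
        l ≤ 101 / 100 * (Fintype.card κ / Fintype.card ι : ℝ) := by
  set p : ℝ := Fintype.card κ / Fintype.card ι with hp
  have hιR : (0 : ℝ) < Fintype.card ι := by exact_mod_cast hι
  have hκR : (0 : ℝ) < Fintype.card κ := by exact_mod_cast hκ
  have hp0 : 0 < p := div_pos hκR hιR
  have hfin : Module.finrank ℂ (κ → ℂ) = Fintype.card κ := by simp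
  have hbasis : ∀ S : Finset ι, ∃ c : ℝ, 0 < c ∧ ((LinearIndepOn ℂ x S ∧ S.card = Fintype.card κ) →
      ∀ w : ι → ℝ, (∀ i, 0 < w i) → (frameMatrix Finset.univ x w).PosDef ∧
        c * ∏ i ∈ S, w i ≤ ‖(frameMatrix Finset.univ x w).det‖) := by
    intro S
    by_cases hS : LinearIndepOn ℂ x S ∧ S.card = Fintype.card κ
    · obtain ⟨c, hc, h⟩ := norm_det_frameMatrix_basis x S hS.1 hS.2
      refine ⟨c, hc, fun _ w hw => ?_⟩
      have hsplit : frameMatrix Finset.univ x w = frameMatrix S x w + frameMatrix Sᶜ x w :=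
        (Finset.sum_add_sum_compl S _).symm
      rw [hsplit, ← (h w hw).2]
      exact ⟨(h w hw).1.add_posSemidef (posSemidef_frameMatrix x w _ fun i => (hw i).le),
        norm_det_le_norm_det_add_frameMatrix x w (h w hw).1 _ fun i => (hw i).le⟩
    · exact ⟨1, one_pos, fun h => absurd h hS⟩
  choose c hc0 hc using hbasis
  obtain ⟨S₀, hS₀⟩ := Finite.exists_min c
  have hgreedy : ∀ w : ι → ℝ, (∀ i, 0 < w i) → (frameMatrix Finset.univ x w).PosDef ∧
      Real.log (c S₀) ≤ Real.log ‖(frameMatrix Finset.univ x w).det‖ - p * ∑ i, Real.log (w i) := by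
    intro w hw
    obtain ⟨S, hS, hSc, hsum⟩ := exists_linearIndepOn_weight_le (K := ℂ) x
      (by simpa only [hfin] using hx) hι (fun i => Real.log (w i))
    rw [hfin] at hSc hsum
    obtain ⟨h1, h2⟩ := hc S ⟨hS, hSc⟩ w hw
    refine ⟨h1, ?_⟩
    have hprod : 0 < ∏ i ∈ S, w i := Finset.prod_pos fun i _ => hw i
    have h3 := Real.log_le_log (mul_pos (hc0 S) hprod) h2
    rw [Real.log_mul (hc0 S).ne' hprod.ne', Real.log_prod fun i _ => (hw i).ne'] at h3
    have h4 := Real.log_le_log (hc0 S₀) (hS₀ S)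
    have h5 : p * ∑ i, Real.log (w i) ≤ ∑ i ∈ S, Real.log (w i) := by
      rw [hp, div_mul_eq_mul_div, div_le_iff₀ hιR]
      linarith
    linarith
  set F : (ι → ℝ) → ℝ := fun w =>
    Real.log ‖(frameMatrix Finset.univ x w).det‖ - p * ∑ i, Real.log (w i) with hF
  have hbdd : BddBelow (F '' {w | ∀ i, 0 < w i}) := by
    refine ⟨Real.log (c S₀), ?_⟩
    rintro _ ⟨w, hw, rfl⟩
    exact (hgreedy w hw).2
  obtain ⟨_, ⟨w, hw, rfl⟩, hmin⟩ := Real.lt_sInf_add_pos (s := F '' {w | ∀ i, 0 < w i})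
    ⟨_, _, fun _ => one_pos, rfl⟩ (show 0 < p / 80000 by positivity)
  have hM := (hgreedy w hw).1
  refine ⟨w, hw, hM, fun i => ?_⟩
  set q : ℂ := (w i : ℂ) * (star (x i) ⬝ᵥ (frameMatrix Finset.univ x w)⁻¹ *ᵥ x i) with hq
  have hq0 : 0 ≤ q := mul_nonneg (by exact_mod_cast (hw i).le)
    (hM.inv.posSemidef.dotProduct_mulVec_nonneg _)
  obtain ⟨l, hl⟩ : ∃ l : ℝ, q = l := ⟨q.re, Complex.ext rfl (Complex.le_def.1 hq0).2.symm⟩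
  have hstep : ∀ a : ℝ, 0 < a → p * Real.log a - p / 80000 ≤ (a - 1) * l := by
    intro a ha
    have hw' : ∀ j, 0 < Function.update w i (a * w i) j := by
      intro j
      by_cases hj : j = i
      · subst hj
        simpa using mul_pos ha (hw j)
      · simpa [Function.update_of_ne hj] using hw j
    have h1 : F w - p / 80000 ≤ F (Function.update w i (a * w i)) := by
      have := csInf_le hbdd ⟨_, hw', rfl⟩
      linarith
    have h2 : ∑ j, Real.log (Function.update w i (a * w i) j) =
        ∑ j, Real.log (w j) + Real.log a := by
      rw [← Finset.add_sum_erase _ _ (Finset.mem_univ i),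
        ← Finset.add_sum_erase _ (fun j => Real.log (w j)) (Finset.mem_univ i),
        Function.update_self, Real.log_mul ha.ne' (hw i).ne']
      rw [Finset.sum_congr rfl fun j hj => by
        rw [Function.update_of_ne (Finset.ne_of_mem_erase hj)]]
      ring
    have h3 : (frameMatrix Finset.univ x (Function.update w i (a * w i))).det =
        (frameMatrix Finset.univ x w).det * ((1 + (a - 1) * l : ℝ) : ℂ) := by
      rw [frameMatrix_update, det_add_smul_vecMulVec_star
        ((isUnit_iff_isUnit_det _).1 hM.isUnit)]
      push_cast
      rw [← hl, hq]
      ring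
    have hpos : 0 < 1 + (a - 1) * l := by
      have h4 := (hgreedy _ hw').1.det_pos
      rw [h3] at h4
      exact_mod_cast (pos_iff_pos_of_mul_pos h4).1 hM.det_pos
    have h5 : Real.log ‖(frameMatrix Finset.univ x (Function.update w i (a * w i))).det‖ =
        Real.log ‖(frameMatrix Finset.univ x w).det‖ + Real.log (1 + (a - 1) * l) := by
      rw [h3, norm_mul, Complex.norm_real, Real.norm_of_nonneg hpos.le,
        Real.log_mul (norm_ne_zero_iff.2 hM.det_pos.ne') hpos.ne']
    have h6 := Real.log_le_sub_one_of_pos hpos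
    simp only [hF, h5, h2] at h1
    linarith
  refine ⟨l, hl, ?_, ?_⟩
  · have h := hstep (201 / 200) (by norm_num)
    have h' := mul_le_mul_of_nonneg_left
      (Real.one_sub_inv_le_log_of_pos (show (0 : ℝ) < 201 / 200 by norm_num)) hp0.le
    linarith
  · have h := hstep (399 / 400) (by norm_num)
    have h' := mul_le_mul_of_nonneg_left
      (Real.one_sub_inv_le_log_of_pos (show (0 : ℝ) < 399 / 400 by norm_num)) hp0.le
    linarith

/-- The columns of the orthogonal projection onto the row space of `Y` have that projection as their
Gram matrix. -/
theorem gram_rowSpace_projection [Fintype κ] [DecidableEq κ] (Y : Matrix κ ι ℂ)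
    (hY : IsUnit (Y * Yᴴ).det) {P : Matrix ι ι ℂ} (hP : P = Yᴴ * (Y * Yᴴ)⁻¹ * Y) :
    (∀ i j, inner ℂ (WithLp.toLp 2 (P.col i)) (WithLp.toLp 2 (P.col j)) = P i j) ∧
      ∑ i, ∑ j, ‖P i j‖ ^ 2 = Fintype.card κ := by
  have hPH : Pᴴ = P := by
    rw [hP, conjTranspose_mul, conjTranspose_mul, conjTranspose_conjTranspose,
      conjTranspose_nonsing_inv, conjTranspose_mul, conjTranspose_conjTranspose, Matrix.mul_assoc]
  have hPP : P * P = P := by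
    calc P * P = Yᴴ * ((Y * Yᴴ)⁻¹ * (Y * Yᴴ) * (Y * Yᴴ)⁻¹) * Y := by
          simp only [hP, Matrix.mul_assoc]
      _ = P := by rw [nonsing_inv_mul _ hY, Matrix.one_mul, hP]
  have hconj : ∀ i j, P i j = star (P j i) := fun i j => by
    rw [← conjTranspose_apply, hPH]
  have hmul : ∀ i j, P i j = ∑ k, P i k * P k j := fun i j => by
    rw [← Matrix.mul_apply, hPP]
  have htr : P.trace = Fintype.card κ := by
    rw [hP, Matrix.mul_assoc, trace_mul_comm, Matrix.mul_assoc, nonsing_inv_mul _ hY, trace_one]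
  refine ⟨fun i j => ?_, ?_⟩
  · rw [PiLp.inner_apply, hmul]
    refine Finset.sum_congr rfl fun k _ => ?_
    rw [hconj i k, RCLike.inner_apply, mul_comm]
    rfl
  · have h2 : ((∑ i, ∑ j, ‖P i j‖ ^ 2 : ℝ) : ℂ) = (Fintype.card κ : ℂ) := by
      rw [Complex.ofReal_sum, ← htr, Matrix.trace]
      refine Finset.sum_congr rfl fun i _ => ?_
      rw [diag_apply, hmul, Complex.ofReal_sum]
      refine Finset.sum_congr rfl fun j _ => ?_
      rw [hconj j i, RCLike.star_def, Complex.mul_conj, Complex.normSq_eq_norm_sq]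
    exact_mod_cast h2

/-- Balanced position: after a linear map and rescaling, the vectors `x i` become a Parseval frame
of the image whose members have nearly equal norms. -/
theorem exists_balanced_position {X : Type*} [AddCommGroup X] [Module ℂ X] [FiniteDimensional ℂ X]
    (x : ι → X)
    (hx : ∀ U : Submodule ℂ X, Module.finrank ℂ X * (Finset.univ.filter fun i => x i ∈ U).card ≤
      Fintype.card ι * Module.finrank ℂ U) (hι : 0 < Fintype.card ι)
    (hX : 0 < Module.finrank ℂ X) :
    ∃ (T : X →ₗ[ℂ] EuclideanSpace ℂ ι) (s : ι → ℂ),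
      ∑ i, ∑ j, ‖inner ℂ (s i • T (x i)) (s j • T (x j))‖ ^ 2 = Module.finrank ℂ X ∧
      ∀ i, 99 / 100 * (Module.finrank ℂ X / Fintype.card ι : ℝ) ≤ ‖s i • T (x i)‖ ^ 2 ∧
        ‖s i • T (x i)‖ ^ 2 ≤ 101 / 100 * (Module.finrank ℂ X / Fintype.card ι : ℝ) := by
  let n := Module.finrank ℂ X
  let φ : X ≃ₗ[ℂ] (Fin n → ℂ) := (Module.finBasis ℂ X).equivFun
  obtain ⟨w, hw, hM, hlev⟩ := exists_weight_leverage_near (fun i => φ (x i)) (by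
    intro U
    have h := hx (U.comap φ.toLinearMap)
    have h2 : Module.finrank ℂ (U.comap φ.toLinearMap) = Module.finrank ℂ U :=
      (φ.submoduleMap (U.comap φ.toLinearMap)).finrank_eq.trans (by
        rw [show Submodule.map φ.toLinearMap (U.comap φ.toLinearMap) = U from
          Submodule.map_comap_eq_of_surjective φ.surjective U])
    rw [h2] at h
    simpa using h) hι (by simpa using hX)
  set M := frameMatrix Finset.univ (fun i => φ (x i)) w with hMdef
  let Y : Matrix (Fin n) ι ℂ := of fun k i => (√(w i) : ℂ) * φ (x i) k
  have hsq : ∀ i, (√(w i) : ℂ) * (√(w i) : ℂ) = w i := fun i => by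
    rw [← Complex.ofReal_mul, Real.mul_self_sqrt (hw i).le]
  have hYM : Y * Yᴴ = M := by
    ext k l
    simp only [hMdef, frameMatrix, Matrix.sum_apply, Matrix.mul_apply, Matrix.smul_apply,
      vecMulVec_apply, conjTranspose_apply, of_apply, Pi.star_apply, smul_eq_mul, Y, star_mul',
      ← hsq, RCLike.star_def, Complex.conj_ofReal]
    exact Finset.sum_congr rfl fun i _ => by ring
  have hMu : IsUnit M.det := (isUnit_iff_isUnit_det _).1 hM.isUnit
  set P : Matrix ι ι ℂ := Yᴴ * M⁻¹ * Y with hP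
  obtain ⟨hgram, hsum⟩ := gram_rowSpace_projection Y (hYM ▸ hMu) (P := P) (by rw [hYM])
  let T : X →ₗ[ℂ] EuclideanSpace ℂ ι :=
    (WithLp.linearEquiv 2 ℂ (ι → ℂ)).symm.toLinearMap ∘ₗ (Yᴴ * M⁻¹).mulVecLin ∘ₗ φ.toLinearMap
  have hT : ∀ i, (√(w i) : ℂ) • T (x i) = WithLp.toLp 2 (P.col i) := by
    intro i
    ext k
    change (√(w i) : ℂ) * ((Yᴴ * M⁻¹) *ᵥ φ (x i)) k = P k i
    rw [hP, Matrix.mul_apply, mulVec, dotProduct, Finset.mul_sum]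
    refine Finset.sum_congr rfl fun j _ => ?_
    change _ = _ * ((√(w i) : ℂ) * φ (x i) j)
    ring
  refine ⟨T, fun i => √(w i), ?_, fun i => ?_⟩
  · simp only [hT, hgram, hsum, Fintype.card_fin]
    rfl
  · obtain ⟨l, hl, h1, h2⟩ := hlev i
    have h3 : P i i = (w i : ℂ) * (star (φ (x i)) ⬝ᵥ M⁻¹ *ᵥ φ (x i)) := by
      rw [hP, Matrix.mul_assoc, Matrix.mul_apply]
      simp only [dotProduct, mulVec, Matrix.mul_apply, Y, conjTranspose_apply, of_apply, star_mul',
        RCLike.star_def, Complex.conj_ofReal, Finset.mul_sum, ← hsq, Pi.star_apply]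
      exact Finset.sum_congr rfl fun j _ => Finset.sum_congr rfl fun k _ => by ring
    have h4 : ‖(√(w i) : ℂ) • T (x i)‖ ^ 2 = l := by
      have h5 : ((‖(√(w i) : ℂ) • T (x i)‖ ^ 2 : ℝ) : ℂ) = l := by
        rw [← hl, ← h3, ← hgram, ← hT, inner_self_eq_norm_sq_to_K]
        simp only [Complex.coe_algebraMap, Complex.ofReal_pow]
      exact_mod_cast h5
    rw [h4]
    simpa only [Fintype.card_fin] using And.intro h1 h2

end balancing

section GramBounds

variable {α H : Type*} [NormedAddCommGroup H] [InnerProductSpace ℂ H]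

theorem sq_sum_sq_norm_le_finrank_mul [FiniteDimensional ℂ H] (s : Finset α) (q : α → H) :
    (∑ i ∈ s, ‖q i‖ ^ 2) ^ 2 ≤
      Module.finrank ℂ H * ∑ i ∈ s, ∑ j ∈ s, ‖inner ℂ (q i) (q j)‖ ^ 2 := by
  let b := stdOrthonormalBasis ℂ H
  let G : Fin (Module.finrank ℂ H) → Fin (Module.finrank ℂ H) → ℂ := fun k l =>
    ∑ i ∈ s, inner ℂ (q i) (b k) * inner ℂ (b l) (q i)
  have hsq : ∀ z : ℂ, ((‖z‖ ^ 2 : ℝ) : ℂ) = z * (starRingEnd ℂ) z := fun z => by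
    rw [Complex.mul_conj, Complex.normSq_eq_norm_sq]
  have hG : ∑ i ∈ s, ∑ j ∈ s, ‖inner ℂ (q i) (q j)‖ ^ 2 = ∑ k, ∑ l, ‖G k l‖ ^ 2 := by
    have h : ((∑ i ∈ s, ∑ j ∈ s, ‖inner ℂ (q i) (q j)‖ ^ 2 : ℝ) : ℂ) =
        ((∑ k, ∑ l, ‖G k l‖ ^ 2 : ℝ) : ℂ) := by
      push_cast
      simp only [← Complex.ofReal_pow, hsq]
      simp only [G, map_sum, map_mul, inner_conj_symm, Finset.sum_mul_sum]
      simp only [← b.sum_inner_mul_inner (q _) (q _), Finset.sum_mul_sum]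
      calc _ = ∑ i ∈ s, ∑ k, ∑ j ∈ s, ∑ l, inner ℂ (q i) (b k) * inner ℂ (b k) (q j) *
            (inner ℂ (q j) (b l) * inner ℂ (b l) (q i)) :=
            Finset.sum_congr rfl fun i _ => Finset.sum_comm
        _ = ∑ k, ∑ i ∈ s, ∑ j ∈ s, ∑ l, inner ℂ (q i) (b k) * inner ℂ (b k) (q j) *
            (inner ℂ (q j) (b l) * inner ℂ (b l) (q i)) := Finset.sum_comm
        _ = ∑ k, ∑ i ∈ s, ∑ l, ∑ j ∈ s, inner ℂ (q i) (b k) * inner ℂ (b k) (q j) *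
            (inner ℂ (q j) (b l) * inner ℂ (b l) (q i)) :=
            Finset.sum_congr rfl fun k _ => Finset.sum_congr rfl fun i _ => Finset.sum_comm
        _ = ∑ k, ∑ l, ∑ i ∈ s, ∑ j ∈ s, inner ℂ (q i) (b k) * inner ℂ (b k) (q j) *
            (inner ℂ (q j) (b l) * inner ℂ (b l) (q i)) :=
            Finset.sum_congr rfl fun k _ => Finset.sum_comm
        _ = _ := Finset.sum_congr rfl fun k _ => Finset.sum_congr rfl fun l _ =>
            Finset.sum_congr rfl fun i _ => Finset.sum_congr rfl fun j _ => by ring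
    exact_mod_cast h
  have hdiag : ∀ k, ∑ i ∈ s, ‖inner ℂ (b k) (q i)‖ ^ 2 = ‖G k k‖ := by
    intro k
    have h : G k k = ((∑ i ∈ s, ‖inner ℂ (b k) (q i)‖ ^ 2 : ℝ) : ℂ) := by
      rw [Complex.ofReal_sum]
      refine Finset.sum_congr rfl fun i _ => ?_
      rw [hsq, inner_conj_symm, mul_comm]
    rw [h, Complex.norm_real, Real.norm_of_nonneg (Finset.sum_nonneg fun i _ => by positivity)]
  have hnorm : ∑ i ∈ s, ‖q i‖ ^ 2 = ∑ k, ‖G k k‖ := by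
    simp only [← hdiag, ← b.sum_sq_norm_inner_right (q _)]
    exact Finset.sum_comm
  rw [hnorm, hG]
  refine sq_sum_le_card_mul_sum_sq.trans ?_
  rw [Finset.card_univ, Fintype.card_fin]
  refine mul_le_mul_of_nonneg_left (Finset.sum_le_sum fun k _ => ?_) (Nat.cast_nonneg _)
  exact Finset.single_le_sum (f := fun l => ‖G k l‖ ^ 2) (fun l _ => by positivity)
    (Finset.mem_univ k)

theorem sq_sum_sq_norm_le_finrank_mul_of_mem (K : Submodule ℂ H) [FiniteDimensional ℂ K]
    (s : Finset α) (q : α → H) (hq : ∀ i ∈ s, q i ∈ K) :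
    (∑ i ∈ s, ‖q i‖ ^ 2) ^ 2 ≤
      Module.finrank ℂ K * ∑ i ∈ s, ∑ j ∈ s, ‖inner ℂ (q i) (q j)‖ ^ 2 := by
  have h := sq_sum_sq_norm_le_finrank_mul s.attach fun i => (⟨q i, hq i i.2⟩ : K)
  simpa only [Submodule.coe_norm, Submodule.coe_inner, Finset.sum_attach s fun i => ‖q i‖ ^ 2,
    fun i => Finset.sum_attach s fun j => ‖inner ℂ (q i) (q j)‖ ^ 2,
    Finset.sum_attach s fun i => ∑ j ∈ s, ‖inner ℂ (q i) (q j)‖ ^ 2] using h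

theorem sum_offDiag_eq_sub [DecidableEq α] (s : Finset α) (f : α × α → ℝ) :
    ∑ z ∈ s.offDiag, f z = ∑ i ∈ s, ∑ j ∈ s, f (i, j) - ∑ i ∈ s, f (i, i) := by
  rw [← Finset.sum_product', ← Finset.diag_union_offDiag,
    Finset.sum_union (Finset.disjoint_diag_offDiag s), Finset.sum_diag]
  ring

/-- Nearly equal-norm vectors lying in a common line or plane are correlated on average. -/
theorem card_mul_le_sum_offDiag_inner [DecidableEq α] (q : α → H) {L L' : Finset α} (hL : L' ⊆ L)
    {c : ℝ} (hc : 0 < c) (hq : ∀ i ∈ L', 99 / 100 * c ≤ ‖q i‖ ^ 2 ∧ ‖q i‖ ^ 2 ≤ 101 / 100 * c)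
    (K : Submodule ℂ H) [FiniteDimensional ℂ K] (hK : ∀ i ∈ L', q i ∈ K) (h3 : 3 ≤ L.card)
    (h : Module.finrank ℂ K ≤ 1 ∧ L'.card + 1 = L.card ∨
      Module.finrank ℂ K ≤ 2 ∧ L'.card = L.card) :
    1 / 5 * c ^ 2 * (L'.card * (L.card - 1)) ≤
      ∑ z ∈ L.offDiag, ‖inner ℂ (q z.1) (q z.2)‖ ^ 2 := by
  have h1 : ∑ z ∈ L'.offDiag, ‖inner ℂ (q z.1) (q z.2)‖ ^ 2 ≤
      ∑ z ∈ L.offDiag, ‖inner ℂ (q z.1) (q z.2)‖ ^ 2 :=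
    Finset.sum_le_sum_of_subset_of_nonneg (Finset.offDiag_mono hL) fun _ _ _ => by positivity
  rw [sum_offDiag_eq_sub] at h1
  have h2 := sq_sum_sq_norm_le_finrank_mul_of_mem K L' q hK
  set G := ∑ i ∈ L', ∑ j ∈ L', ‖inner ℂ (q i) (q j)‖ ^ 2
  have hG : 0 ≤ G := Finset.sum_nonneg fun _ _ => Finset.sum_nonneg fun _ _ => by positivity
  have hdiag : ∑ i ∈ L', ‖inner ℂ (q i) (q i)‖ ^ 2 ≤ L'.card * (101 / 100 * c) ^ 2 := by
    rw [← nsmul_eq_mul]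
    refine Finset.sum_le_card_nsmul _ _ _ fun i hi => ?_
    rw [inner_self_eq_norm_sq_to_K, norm_pow]
    simp only [Complex.coe_algebraMap, Complex.norm_real, norm_norm]
    exact pow_le_pow_left₀ (by positivity) (hq i hi).2 2
  have hsum : L'.card * (99 / 100 * c) ≤ ∑ i ∈ L', ‖q i‖ ^ 2 := by
    rw [← nsmul_eq_mul]
    exact Finset.card_nsmul_le_sum _ _ _ fun i hi => (hq i hi).1
  have hsq : (L'.card * (99 / 100 * c)) ^ 2 ≤ (∑ i ∈ L', ‖q i‖ ^ 2) ^ 2 :=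
    pow_le_pow_left₀ (by positivity) hsum 2
  refine le_trans ?_ h1
  have h3' : (3 : ℝ) ≤ L.card := by exact_mod_cast h3
  have hc2 : 0 < c ^ 2 := by positivity
  rcases h with ⟨hk, hr⟩ | ⟨hk, hr⟩
  · have hk' : (Module.finrank ℂ K : ℝ) ≤ 1 := by exact_mod_cast hk
    have hr' : (L.card : ℝ) = L'.card + 1 := by exact_mod_cast hr.symm
    have h4 := mul_le_mul_of_nonneg_right hk' hG
    rw [hr'] at h3' ⊢
    have h5 : 0 ≤ c ^ 2 * (L'.card * ((L'.card : ℝ) - 2)) :=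
      mul_nonneg hc2.le (mul_nonneg (Nat.cast_nonneg _) (by linarith))
    have h6 : 0 ≤ c ^ 2 * (L'.card : ℝ) := by positivity
    nlinarith
  · have hk' : (Module.finrank ℂ K : ℝ) ≤ 2 := by exact_mod_cast hk
    have hr' : (L.card : ℝ) = L'.card := by exact_mod_cast hr.symm
    have h4 := mul_le_mul_of_nonneg_right hk' hG
    rw [hr'] at h3' ⊢
    have h5 : 0 ≤ c ^ 2 * (L'.card * ((L'.card : ℝ) - 3)) :=
      mul_nonneg hc2.le (mul_nonneg (Nat.cast_nonneg _) (by linarith))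
    have h6 : 0 ≤ c ^ 2 * (L'.card : ℝ) := by positivity
    nlinarith

end GramBounds

section Quotient

variable {ι E : Type*} [Fintype ι] [AddCommGroup E] [Module ℂ E] [FiniteDimensional ℂ E]

/-- Among the proper subspaces through `z`, one minimises the number of outside points per
codimension. -/
theorem exists_min_card_div_codim (y : ι → E) (z : E) (hz : ∃ W : Submodule ℂ E, z ∈ W ∧ W ≠ ⊤) :
    ∃ W : Submodule ℂ E, z ∈ W ∧ W ≠ ⊤ ∧ ∀ U : Submodule ℂ E, z ∈ U →
      (Finset.univ.filter fun i => y i ∉ W).card * Module.finrank ℂ (E ⧸ U) ≤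
        (Finset.univ.filter fun i => y i ∉ U).card * Module.finrank ℂ (E ⧸ W) := by
  let g : Submodule ℂ E → ℕ × ℕ := fun W =>
    ((Finset.univ.filter fun i => y i ∉ W).card, Module.finrank ℂ (E ⧸ W))
  have hfin : (g '' {W | z ∈ W ∧ W ≠ ⊤}).Finite := by
    refine (((Set.finite_Iic (Fintype.card ι)).prod
      (Set.finite_Iic (Module.finrank ℂ E)))).subset ?_
    rintro _ ⟨W, -, rfl⟩
    exact ⟨Finset.card_le_univ _, Submodule.finrank_quotient_le _⟩
  obtain ⟨_, ⟨W, hW, rfl⟩, hmin⟩ := Set.exists_min_image _ (fun p : ℕ × ℕ => (p.1 / p.2 : ℚ)) hfin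
    (by obtain ⟨W, hW⟩ := hz; exact ⟨_, W, hW, rfl⟩)
  have hpos : ∀ U : Submodule ℂ E, U ≠ ⊤ → 0 < Module.finrank ℂ (E ⧸ U) := fun U hU => by
    have := Submodule.Quotient.nontrivial_iff.2 hU
    exact Module.finrank_pos
  refine ⟨W, hW.1, hW.2, fun U hU => ?_⟩
  by_cases hU' : U = ⊤
  · have : Module.finrank ℂ (E ⧸ U) = 0 := by
      have := Submodule.Quotient.subsingleton_iff.2 hU'
      exact Module.finrank_zero_of_subsingleton
    rw [this]
    simp
  · have h := hmin _ ⟨U, ⟨hU, hU'⟩, rfl⟩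
    have h1 := hpos U hU'
    have h2 := hpos W hW.2
    simp only [g] at h
    rw [div_le_div_iff₀ (by exact_mod_cast h2) (by exact_mod_cast h1)] at h
    exact_mod_cast h

/-- The points outside such a minimising subspace can be put in balanced position in the
quotient. -/
theorem exists_balanced_quotient (y : ι → E) (W : Submodule ℂ E) (hW : W ≠ ⊤)
    (hy : Submodule.span ℂ (Set.range y) = ⊤)
    (hmin : ∀ U : Submodule ℂ E, W ≤ U →
      (Finset.univ.filter fun i => y i ∉ W).card * Module.finrank ℂ (E ⧸ U) ≤
        (Finset.univ.filter fun i => y i ∉ U).card * Module.finrank ℂ (E ⧸ W)) :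
    ∃ (T : E ⧸ W →ₗ[ℂ] EuclideanSpace ℂ {i // y i ∉ W}) (s : ι → ℂ),
      ∑ i, ∑ j, ‖inner ℂ (s i • T (W.mkQ (y i))) (s j • T (W.mkQ (y j)))‖ ^ 2 =
        Module.finrank ℂ (E ⧸ W) ∧
      ∀ i, y i ∉ W →
        99 / 100 * (Module.finrank ℂ (E ⧸ W) / (Finset.univ.filter fun i => y i ∉ W).card : ℝ) ≤
          ‖s i • T (W.mkQ (y i))‖ ^ 2 ∧
        ‖s i • T (W.mkQ (y i))‖ ^ 2 ≤
          101 / 100 * (Module.finrank ℂ (E ⧸ W) / (Finset.univ.filter fun i => y i ∉ W).card : ℝ) := by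
  have hcard : Fintype.card {i // y i ∉ W} = (Finset.univ.filter fun i => y i ∉ W).card :=
    Fintype.card_subtype _
  have hne : 0 < Fintype.card {i // y i ∉ W} := by
    rw [Fintype.card_pos_iff]
    by_contra hempty
    refine hW (top_le_iff.1 (hy ▸ Submodule.span_le.2 ?_))
    rintro _ ⟨i, rfl⟩
    by_contra hi
    exact hempty ⟨⟨i, hi⟩⟩
  have hquot : 0 < Module.finrank ℂ (E ⧸ W) := by
    have := Submodule.Quotient.nontrivial_iff.2 hW
    exact Module.finrank_pos
  obtain ⟨T, s, hsum, hnorm⟩ := exists_balanced_position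
    (fun i : {i // y i ∉ W} => W.mkQ (y i)) (by
      intro U
      have hle : W ≤ U.comap W.mkQ := Submodule.le_comap_mkQ W U
      have h := hmin (U.comap W.mkQ) hle
      have h1 : Module.finrank ℂ (E ⧸ U.comap W.mkQ) + Module.finrank ℂ U =
          Module.finrank ℂ (E ⧸ W) := by
        have h2 := (Submodule.quotientQuotientEquivQuotient W (U.comap W.mkQ) hle).finrank_eq
        rw [Submodule.map_comap_eq_of_surjective W.mkQ_surjective] at h2
        rw [← h2]
        exact Submodule.finrank_quotient_add_finrank U
      have h3 : (Finset.univ.filter fun i : {i // y i ∉ W} => W.mkQ (y i) ∈ U).card +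
          (Finset.univ.filter fun i => y i ∉ U.comap W.mkQ).card =
          (Finset.univ.filter fun i => y i ∉ W).card := by
        have h4 : (Finset.univ.filter fun i : {i // y i ∉ W} => W.mkQ (y i) ∈ U).card =
            ((Finset.univ.filter fun i => y i ∉ W).filter fun i => W.mkQ (y i) ∈ U).card := by
          rw [← Finset.card_map (Function.Embedding.subtype _)]
          congr 1
          ext i
          simp only [Finset.mem_map, Finset.mem_filter, Finset.mem_univ, true_and, Subtype.exists,
            Function.Embedding.subtype_apply]
          exact ⟨fun ⟨_, ha, hU, h⟩ => h ▸ ⟨ha, hU⟩, fun ⟨ha, hU⟩ => ⟨i, ha, hU, rfl⟩⟩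
        have h5 : (Finset.univ.filter fun i => y i ∉ U.comap W.mkQ) =
            (Finset.univ.filter fun i => y i ∉ W).filter fun i => ¬ W.mkQ (y i) ∈ U := by
          ext i
          simp only [Finset.mem_filter, Finset.mem_univ, true_and, Submodule.mem_comap]
          exact ⟨fun h => ⟨fun hi => h (hle hi), h⟩, fun h => h.2⟩
        rw [h4, h5]
        exact Finset.card_filter_add_card_filter_not _
      rw [hcard]
      rw [← h3, ← h1] at h ⊢
      nlinarith) hne hquot
  rw [hcard] at hnorm
  refine ⟨T, fun i => if h : y i ∉ W then s ⟨i, h⟩ else 0, ?_, fun i hi => ?_⟩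
  · have hext : ∀ F : ι → ℝ, (∀ i, y i ∈ W → F i = 0) → ∑ i, F i = ∑ i : {i // y i ∉ W}, F i := by
      intro F hF
      rw [← Finset.sum_subtype (Finset.univ.filter fun i => y i ∉ W) (by simp) F]
      refine (Finset.sum_subset (Finset.filter_subset _ _) fun i _ hi => hF i ?_).symm
      simpa using hi
    rw [← hsum, hext _ fun i hi => Finset.sum_eq_zero fun j _ => by simp [hi]]
    refine Finset.sum_congr rfl fun i _ => ?_
    rw [hext _ fun j hj => by simp [hj]]
    refine Finset.sum_congr rfl fun j _ => ?_
    beta_reduce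
    rw [dif_pos i.2, dif_pos j.2]
  · beta_reduce
    rw [dif_pos hi]
    exact hnorm ⟨i, hi⟩

end Quotient

section Planes

variable {ι E : Type*} [AddCommGroup E] [Module ℂ E]

/-- The plane spanned by the two vectors indexed by a pair. -/
def pairSpan (y : ι → E) (z : ι × ι) : Submodule ℂ E := Submodule.span ℂ {y z.1, y z.2}

theorem pairSpan_eq_of_mem {y : ι → E} (hy : ∀ i j, i ≠ j → LinearIndependent ℂ ![y i, y j])
    (z : ι × ι) {i j : ι} (hij : i ≠ j) (hi : y i ∈ pairSpan y z) (hj : y j ∈ pairSpan y z) :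
    pairSpan y (i, j) = pairSpan y z := by
  have hle : pairSpan y (i, j) ≤ pairSpan y z :=
    Submodule.span_le.2 (Set.insert_subset hi (Set.singleton_subset_iff.2 hj))
  have hfd : FiniteDimensional ℂ (pairSpan y z) :=
    FiniteDimensional.span_of_finite ℂ (Set.toFinite _)
  refine Submodule.eq_of_le_of_finrank_le hle ?_
  have h2 : Module.finrank ℂ (pairSpan y (i, j)) = 2 := by
    have h := finrank_span_eq_card (hy i j hij)
    rwa [Matrix.range_cons_cons_empty] at h
  rw [h2]
  exact (finrank_span_le_card _).trans (by simpa using Finset.card_le_two)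

theorem exists_pairSpan_rank_bound [Fintype ι] [FiniteDimensional ℂ E] {H : Type*} [AddCommGroup H]
    [Module ℂ H] {y : ι → E} (hy : ∀ i j, i ≠ j → LinearIndependent ℂ ![y i, y j])
    (W : Submodule ℂ E) (T : E ⧸ W →ₗ[ℂ] H) (z : ι × ι) {L : Finset ι}
    (hL : L = Finset.univ.filter fun i => y i ∈ pairSpan y z) (h3 : 3 ≤ L.card) :
    L.filter (fun i => y i ∉ W) = ∅ ∨ ∃ K : Submodule ℂ H, FiniteDimensional ℂ K ∧
      (∀ i ∈ L, T (W.mkQ (y i)) ∈ K) ∧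
      (Module.finrank ℂ K ≤ 1 ∧ (L.filter fun i => y i ∉ W).card + 1 = L.card ∨
        Module.finrank ℂ K ≤ 2 ∧ (L.filter fun i => y i ∉ W).card = L.card) := by
  have hmem : ∀ i, i ∈ L ↔ y i ∈ pairSpan y z := fun i => by simp [hL]
  by_cases hW : ∃ a ∈ L, y a ∈ W
  · obtain ⟨a, ha, haW⟩ := hW
    by_cases hW' : ∃ b ∈ L, b ≠ a ∧ y b ∈ W
    · left
      obtain ⟨b, hb, hba, hbW⟩ := hW'
      refine Finset.filter_eq_empty_iff.2 fun i hi => not_not.2 ?_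
      have h := pairSpan_eq_of_mem hy z hba ((hmem b).1 hb) ((hmem a).1 ha)
      have hle : pairSpan y (b, a) ≤ W :=
        Submodule.span_le.2 (Set.insert_subset hbW (Set.singleton_subset_iff.2 haW))
      exact hle (h ▸ (hmem i).1 hi)
    · right
      push Not at hW'
      obtain ⟨b, hb, hba⟩ := Finset.exists_mem_ne (by omega : 1 < L.card) a
      refine ⟨Submodule.span ℂ {T (W.mkQ (y b))}, inferInstance, fun i hi => ?_, Or.inl ⟨?_, ?_⟩⟩
      · have h := (hmem i).1 hi
        rw [← pairSpan_eq_of_mem hy z hba ((hmem b).1 hb) ((hmem a).1 ha)] at h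
        obtain ⟨c, d, h⟩ := Submodule.mem_span_pair.1 h
        have h0 : W.mkQ (y a) = 0 := by simpa using haW
        rw [← h, map_add, map_smul, map_smul, h0, smul_zero, add_zero, map_smul]
        exact Submodule.smul_mem _ _ (Submodule.mem_span_singleton_self _)
      · have h := finrank_span_finset_le_card (R := ℂ) ({T (W.mkQ (y b))} : Finset H)
        rwa [Finset.coe_singleton, Finset.card_singleton] at h
      · have h : L.filter (fun i => y i ∉ W) = L.erase a := by
          ext i
          simp only [Finset.mem_filter, Finset.mem_erase]
          exact ⟨fun h => ⟨fun hi => h.2 (hi ▸ haW), h.1⟩, fun h => ⟨h.2, hW' i h.2 h.1⟩⟩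
        rw [h, Finset.card_erase_add_one ha]
  · right
    push Not at hW
    refine ⟨(pairSpan y z).map (T ∘ₗ W.mkQ), inferInstance,
      fun i hi => ⟨y i, (hmem i).1 hi, rfl⟩, Or.inr ⟨?_, ?_⟩⟩
    · exact (Submodule.finrank_map_le _ _).trans
        ((finrank_span_le_card _).trans (by simpa using Finset.card_le_two))
    · rw [Finset.filter_true_of_mem hW]

/-- Linear version of the theorem: pairwise independent vectors with many coplanar triples have
small rank. -/
theorem finrank_sub_one_mul_le [Fintype ι] [FiniteDimensional ℂ E] {y : ι → E} {δ m : ℝ}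
    (hδ : 0 ≤ δ * m) (hy : ∀ i j, i ≠ j → LinearIndependent ℂ ![y i, y j])
    (hspan : Submodule.span ℂ (Set.range y) = ⊤) (o : ι) (hm : (Fintype.card ι : ℝ) = m + 1)
    (hdim : 1 < Module.finrank ℂ E)
    (hSG : ∀ i, i ≠ o → ∃ J : Finset ι, δ * m ≤ (J.card : ℝ) ∧
      ∀ j ∈ J, j ≠ i ∧ ∃ k, k ≠ i ∧ k ≠ j ∧ y k ∈ pairSpan y (i, j)) :
    δ * m * (Module.finrank ℂ E - 1) ≤ 5 * m := by
  have hproper : (ℂ ∙ y o) ≠ ⊤ := fun h => by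
    have h1 : Module.finrank ℂ (ℂ ∙ y o) ≤ 1 := by
      simpa using finrank_span_le_card (R := ℂ) ({y o} : Set E)
    rw [h, finrank_top] at h1
    omega
  obtain ⟨W, hoW, hW, hmin⟩ := exists_min_card_div_codim y (y o)
    ⟨ℂ ∙ y o, Submodule.mem_span_singleton_self _, hproper⟩
  obtain ⟨T, s, hsum, hnorm⟩ := exists_balanced_quotient y W hW hspan fun U hU => hmin U (hU hoW)
  set N := (Finset.univ.filter fun i => y i ∉ W).card with hN
  set n := Module.finrank ℂ (E ⧸ W) with hn
  have hn0 : 0 < n := by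
    have := Submodule.Quotient.nontrivial_iff.2 hW
    exact Module.finrank_pos
  have hn0' : (0 : ℝ) < n := by exact_mod_cast hn0
  have hN0 : 0 < N := by
    rw [Finset.card_pos]
    by_contra hempty
    rw [Finset.not_nonempty_iff_eq_empty, Finset.filter_eq_empty_iff] at hempty
    refine hW (top_le_iff.1 (hspan ▸ Submodule.span_le.2 ?_))
    rintro _ ⟨i, rfl⟩
    exact not_not.1 (hempty (Finset.mem_univ i))
  have hN0' : (0 : ℝ) < N := by exact_mod_cast hN0
  have hratio : (N : ℝ) * (Module.finrank ℂ E - 1) ≤ m * n := by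
    have h := hmin (ℂ ∙ y o) (Submodule.mem_span_singleton_self _)
    have h1 : Module.finrank ℂ E ≤ Module.finrank ℂ (E ⧸ (ℂ ∙ y o)) + 1 := by
      have h2 := Submodule.finrank_quotient_add_finrank (ℂ ∙ y o)
      have h3 : Module.finrank ℂ (ℂ ∙ y o) ≤ 1 := by
        simpa using finrank_span_le_card (R := ℂ) ({y o} : Set E)
      omega
    have h2 : (Finset.univ.filter fun i => y i ∉ (ℂ ∙ y o)).card + 1 ≤ Fintype.card ι := by
      have h3 : (Finset.univ.filter fun i => y i ∉ (ℂ ∙ y o)) ⊂ Finset.univ :=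
        Finset.filter_ssubset.2 ⟨o, Finset.mem_univ o,
          not_not.2 (Submodule.mem_span_singleton_self _)⟩
      exact Finset.card_lt_card h3
    have h1' : (Module.finrank ℂ E : ℝ) ≤ Module.finrank ℂ (E ⧸ (ℂ ∙ y o)) + 1 := by
      exact_mod_cast h1
    have h2' : ((Finset.univ.filter fun i => y i ∉ (ℂ ∙ y o)).card : ℝ) + 1 ≤ m + 1 := by
      rw [← hm]
      exact_mod_cast h2
    have h' : (N : ℝ) * Module.finrank ℂ (E ⧸ (ℂ ∙ y o)) ≤
        (Finset.univ.filter fun i => y i ∉ (ℂ ∙ y o)).card * n := by exact_mod_cast h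
    nlinarith
  set p : ℝ := n / N with hp
  have hp0 : 0 < p := div_pos hn0' hN0'
  let q : ι → EuclideanSpace ℂ {i // y i ∉ W} := fun i => s i • T (W.mkQ (y i))
  let f : ι × ι → ℝ := fun z => ‖inner ℂ (q z.1) (q z.2)‖ ^ 2
  let g : ι × ι → ℝ := fun z => if y z.1 ∉ W then 1 / 5 * p ^ 2 else 0
  let S : Finset (ι × ι) := Finset.univ.filter fun z =>
    z.2 ≠ z.1 ∧ ∃ k, k ≠ z.1 ∧ k ≠ z.2 ∧ y k ∈ pairSpan y z
  have hself : ∀ z : ι × ι, y z.1 ∈ pairSpan y z ∧ y z.2 ∈ pairSpan y z := fun z =>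
    ⟨Submodule.subset_span (by simp), Submodule.subset_span (by simp)⟩
  have hfiber : ∀ a ∈ S, ∑ z ∈ S with pairSpan y z = pairSpan y a, g z ≤
      ∑ z ∈ S with pairSpan y z = pairSpan y a, f z := by
    intro a ha
    obtain ⟨L, hL⟩ : ∃ L, L = Finset.univ.filter fun i => y i ∈ pairSpan y a := ⟨_, rfl⟩
    have hmem : ∀ i, i ∈ L ↔ y i ∈ pairSpan y a := fun i => by simp [hL]
    have h3 : 3 ≤ L.card := by
      obtain ⟨h1, k, hk1, hk2, hk⟩ := (Finset.mem_filter.1 ha).2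
      have h4 : ({a.1, a.2, k} : Finset ι).card = 3 :=
        Finset.card_eq_three.2 ⟨_, _, _, h1.symm, hk1.symm, hk2.symm, rfl⟩
      rw [← h4]
      refine Finset.card_le_card fun i hi => (hmem i).2 ?_
      simp only [Finset.mem_insert, Finset.mem_singleton] at hi
      rcases hi with rfl | rfl | rfl
      exacts [(hself a).1, (hself a).2, hk]
    have hoff : (S.filter fun z => pairSpan y z = pairSpan y a) = L.offDiag := by
      ext ⟨i, j⟩
      simp only [Finset.mem_filter, Finset.mem_offDiag, hmem]
      constructor
      · rintro ⟨h, he⟩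
        rw [← he]
        exact ⟨(hself (i, j)).1, (hself (i, j)).2, (Finset.mem_filter.1 h).2.1.symm⟩
      · rintro ⟨hi, hj, hij⟩
        have he := pairSpan_eq_of_mem hy a hij hi hj
        refine ⟨Finset.mem_filter.2 ⟨Finset.mem_univ _, hij.symm, ?_⟩, he⟩
        obtain ⟨k, hkL, hk⟩ := Finset.exists_mem_notMem_of_card_lt_card
          (s := {i, j}) (t := L) (lt_of_le_of_lt Finset.card_le_two h3)
        simp only [Finset.mem_insert, Finset.mem_singleton, not_or] at hk
        exact ⟨k, hk.1, hk.2, he ▸ (hmem k).1 hkL⟩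
    have hg : ∑ z ∈ L.offDiag, g z =
        1 / 5 * p ^ 2 * ((L.filter fun i => y i ∉ W).card * (L.card - 1)) := by
      have hrow : ∀ i ∈ L, ∑ j ∈ L, g (i, j) = L.card • if y i ∉ W then 1 / 5 * p ^ 2 else 0 :=
        fun i _ => Finset.sum_const (g (i, i))
      have hdiag : ∀ i ∈ L, g (i, i) = if y i ∉ W then 1 / 5 * p ^ 2 else 0 := fun i _ => rfl
      rw [sum_offDiag_eq_sub, Finset.sum_congr rfl hrow, Finset.sum_congr rfl hdiag,
        ← Finset.smul_sum, ← Finset.sum_filter, Finset.sum_const, nsmul_eq_mul, nsmul_eq_mul]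
      ring
    rw [hoff, hg]
    rcases exists_pairSpan_rank_bound hy W T a hL h3 with h0 | ⟨K, hKfd, hK, hcase⟩
    · rw [h0]
      simpa using Finset.sum_nonneg fun z _ => by positivity
    · exact card_mul_le_sum_offDiag_inner q (Finset.filter_subset _ _) hp0
        (fun i hi => hnorm i (Finset.mem_filter.1 hi).2) K
        (fun i hi => K.smul_mem _ (hK i (Finset.mem_filter.1 hi).1)) h3 hcase
  have hSsum : ∑ z ∈ S, g z ≤ ∑ z ∈ S, f z := by
    rw [← Finset.sum_fiberwise_of_maps_to (t := S.image (pairSpan y))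
        (fun z hz => Finset.mem_image_of_mem _ hz) g,
      ← Finset.sum_fiberwise_of_maps_to (t := S.image (pairSpan y))
        (fun z hz => Finset.mem_image_of_mem _ hz) f]
    refine Finset.sum_le_sum fun P hP => ?_
    obtain ⟨a, ha, rfl⟩ := Finset.mem_image.1 hP
    exact hfiber a ha
  have hupper : ∑ z ∈ S, f z ≤ n := by
    rw [← hsum, ← Finset.sum_product']
    exact Finset.sum_le_sum_of_subset_of_nonneg (Finset.subset_univ _) fun _ _ _ => by positivity
  have hlower : N * (1 / 5 * p ^ 2 * (δ * m)) ≤ ∑ z ∈ S, g z := by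
    rw [Finset.sum_filter, ← Finset.univ_product_univ, Finset.sum_product, hN, ← nsmul_eq_mul,
      ← Finset.sum_const, Finset.sum_filter]
    refine Finset.sum_le_sum fun i _ => ?_
    rw [← Finset.sum_filter]
    by_cases hi : y i ∈ W
    · simp [g, hi]
    · have hio : i ≠ o := fun h => hi (h ▸ hoW)
      simp only [g, hi, not_false_eq_true, if_true, Finset.sum_const, nsmul_eq_mul]
      rw [mul_comm]
      obtain ⟨J, hJcard, hJ⟩ := hSG i hio
      refine mul_le_mul_of_nonneg_right (hJcard.trans ?_) (by positivity)
      exact Nat.cast_le.2 (Finset.card_le_card fun j hj =>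
        Finset.mem_filter.2 ⟨Finset.mem_univ j, hJ j hj⟩)
  have hfinal : p * (δ * m) ≤ 5 := by
    have h1 := hlower.trans (hSsum.trans hupper)
    have h2 : (n : ℝ) = N * p := by rw [hp]; field_simp
    rw [h2] at h1
    have h3 : N * p * (p * (δ * m)) ≤ N * p * 5 := by linarith
    exact le_of_mul_le_mul_left h3 (mul_pos hN0' hp0)
  have h4 : n * (δ * m) ≤ 5 * N := by
    rw [hp, div_mul_eq_mul_div, div_le_iff₀ hN0'] at hfinal
    exact hfinal
  have h5 : (0 : ℝ) ≤ m := by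
    have : 1 ≤ Fintype.card ι := Fintype.card_pos_iff.2 ⟨o⟩
    have : (1 : ℝ) ≤ Fintype.card ι := by exact_mod_cast this
    linarith
  have h6 : N * (δ * m * (Module.finrank ℂ E - 1)) ≤ N * (5 * m) := by
    nlinarith [mul_le_mul_of_nonneg_left hratio hδ, mul_le_mul_of_nonneg_left h4 h5]
  exact le_of_mul_le_mul_left h6 hN0'

end Planes

theorem linearIndependent_homogenization {V : Type*} [AddCommGroup V] [Module ℂ V] {a b : V}
    (hab : a ≠ b) : LinearIndependent ℂ ![((1 : ℂ), a), (1, b)] := by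
  rw [LinearIndependent.pair_iff]
  intro s t h
  obtain ⟨h1, h2⟩ := Prod.ext_iff.1 h
  simp only [Prod.fst_add, Prod.smul_fst, smul_eq_mul, mul_one, Prod.fst_zero, Prod.snd_add,
    Prod.smul_snd, Prod.snd_zero] at h1 h2
  rw [eq_neg_of_add_eq_zero_right h1, neg_smul, ← sub_eq_add_neg, ← smul_sub, smul_eq_zero,
    sub_eq_zero] at h2
  have hs : s = 0 := h2.resolve_right hab
  exact ⟨hs, by simpa [hs] using h1⟩

/-- **Robust Sylvester–Gallai theorem with one exceptional point.**
Let `0 < δ < 1` and let `v 0, v 1, …, v m` be distinct points of `ℂ^d` such that for every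
`i ≠ 0` there are at least `δ·m` indices `j ≠ 0, i` for which the line through `v i` and
`v j` contains a third point `v k`, `k ∉ {i, j}`. Then the span of all the points has
dimension less than `50 / δ`. -/
theorem stmt_4 (d m : ℕ) (δ : ℝ) (hδ0 : 0 < δ) (hδ1 : δ < 1)
    (v : Fin (m + 1) → (Fin d → ℂ)) (hdist : Function.Injective v)
    (hSG : ∀ i : Fin (m + 1), i ≠ 0 →
      δ * (m : ℝ) ≤
        ((Finset.univ.filter (fun j : Fin (m + 1) => j ≠ 0 ∧ j ≠ i ∧
          ∃ k : Fin (m + 1), k ≠ i ∧ k ≠ j ∧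
            ∃ t : ℂ, v k = v i + t • (v j - v i))).card : ℝ)) :
    (Module.finrank ℂ ↥(Submodule.span ℂ (Set.range v)) : ℝ) < 50 / δ := by
  let u : Fin (m + 1) → ℂ × (Fin d → ℂ) := fun i => (1, v i)
  let E := Submodule.span ℂ (Set.range u)
  let y : Fin (m + 1) → E := fun i => ⟨u i, Submodule.subset_span ⟨i, rfl⟩⟩
  have hle : Module.finrank ℂ (Submodule.span ℂ (Set.range v)) ≤ Module.finrank ℂ E := by
    have h : Submodule.span ℂ (Set.range v) =
        E.map (LinearMap.snd ℂ ℂ (Fin d → ℂ)) := by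
      rw [Submodule.map_span, ← Set.range_comp]
      rfl
    rw [h]
    exact Submodule.finrank_map_le _ _
  have hspan : Submodule.span ℂ (Set.range y) = ⊤ := by
    apply Submodule.map_injective_of_injective E.injective_subtype
    rw [Submodule.map_span, ← Set.range_comp, Submodule.map_top, Submodule.range_subtype]
    rfl
  have hy : ∀ i j, i ≠ j → LinearIndependent ℂ ![y i, y j] := by
    intro i j hij
    refine LinearIndependent.of_comp E.subtype ?_
    have h := linearIndependent_homogenization (hdist.ne hij)
    convert h using 1
    ext k
    · fin_cases k <;> rfl
    · fin_cases k <;> rfl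
  have hmain : 1 < Module.finrank ℂ E → δ * m * (Module.finrank ℂ E - 1) ≤ 5 * m := by
    intro hdim
    refine finrank_sub_one_mul_le (by positivity) hy hspan 0 (by simp) hdim fun i hi => ?_
    refine ⟨_, hSG i hi, fun j hj => ?_⟩
    obtain ⟨-, -, hji, k, hki, hkj, t, ht⟩ := Finset.mem_filter.1 hj
    refine ⟨hji, k, hki, hkj, ?_⟩
    refine Submodule.mem_span_pair.2 ⟨1 - t, t, Subtype.ext (Prod.ext ?_ ?_)⟩
    · simp [y, u]
    · simp only [y, u, Submodule.coe_add, Submodule.coe_smul, Prod.snd_add, Prod.smul_snd, ht]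
      module
  have hbound : (Module.finrank ℂ E : ℝ) < 50 / δ := by
    rw [lt_div_iff₀ hδ0]
    rcases Nat.lt_or_ge 1 (Module.finrank ℂ E) with hdim | hdim
    · have h := hmain hdim
      have hm : 0 < m := by
        have h1 : Module.finrank ℂ E ≤ Fintype.card (Fin (m + 1)) :=
          finrank_range_le_card (R := ℂ) u
        rw [Fintype.card_fin] at h1
        omega
      have hm' : (0 : ℝ) < m := by exact_mod_cast hm
      have h2 : m * (δ * (Module.finrank ℂ E - 1)) ≤ m * 5 := by linarith
      have h3 := le_of_mul_le_mul_left h2 hm'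
      linarith
    · have h : (Module.finrank ℂ E : ℝ) ≤ 1 := by exact_mod_cast hdim
      nlinarith
  exact lt_of_le_of_lt (by exact_mod_cast hle) hbound
end

section
/- For a quadratic polynomial Q over ℂ, let rank_s(Q) denote the minimal r such that Q = Σ_{i=1}^r a_i·b_i for some linear forms a_1, b_1, …, a_r, b_r; an expression of Q as such a sum with exactly rank_s(Q) products is called a minimal representation. Let Q be an irreducible homogeneous quadratic polynomial in ℂ[x_1, …, x_n] with rank_s(Q) = r, and let Q = Σ_{i=1}^r a_{2i−1}·a_{2i} and Q = Σ_{i=1}^r b_{2i−1}·b_{2i} be two minimal representations of Q. Then the ℂ-linear span of {a_1, …, a_{2r}} equals the ℂ-linear span of {b_1, …, b_{2r}}. -/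
open MvPolynomial

/-- The substitution `X k ↦ X k - f (X k) • p` acts on every linear form `l` as
`l ↦ l - f l • p`. -/
theorem aeval_X_sub_smul_of_isHomogeneous_one {σ K : Type*} [Field K]
    (f : MvPolynomial σ K →ₗ[K] K) (p : MvPolynomial σ K) {l : MvPolynomial σ K}
    (hl : l.IsHomogeneous 1) :
    aeval (fun k => X k - f (X k) • p) l = l - f l • p := by
  have hspan : l ∈ Submodule.span K (Set.range (X : σ → MvPolynomial σ K)) := by
    rw [← homogeneousSubmodule_one_eq_span_X]
    exact hl
  clear hl
  induction hspan using Submodule.span_induction with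
  | mem _ h => obtain ⟨k, rfl⟩ := h; simp
  | zero => simp
  | add x y _ _ hx hy => simp only [map_add, hx, hy, add_smul]; ring
  | smul c x _ hx => simp only [map_smul, hx, smul_sub, smul_smul, smul_eq_mul]

/-- A left factor of a minimal representation of `∑ i, a i * b i` as a sum of products of linear
forms lies in the span of the linear forms of any other representation. -/
theorem left_factor_mem_span_of_minimal {σ ι K : Type*} [Field K] [Fintype ι] {r : ℕ}
    {Q : MvPolynomial σ K} {a b : Fin r → MvPolynomial σ K} {a' b' : ι → MvPolynomial σ K}
    (ha : ∀ i, (a i).IsHomogeneous 1) (hb : ∀ i, (b i).IsHomogeneous 1)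
    (ha' : ∀ i, (a' i).IsHomogeneous 1) (hb' : ∀ i, (b' i).IsHomogeneous 1)
    (hrep : Q = ∑ i, a i * b i) (hrep' : Q = ∑ i, a' i * b' i)
    (hmin : ∀ s : ℕ, s < r → ∀ c d : Fin s → MvPolynomial σ K,
      (∀ i, (c i).IsHomogeneous 1) → (∀ i, (d i).IsHomogeneous 1) → Q ≠ ∑ i, c i * d i)
    (i : Fin r) : a i ∈ Submodule.span K (Set.range a' ∪ Set.range b') := by
  by_contra hi
  obtain ⟨f, hfi, hf⟩ := Submodule.exists_le_ker_of_notMem hi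
  have hfa' (j) : f (a' j) = 0 := hf (Submodule.subset_span (.inl ⟨j, rfl⟩))
  have hfb' (j) : f (b' j) = 0 := hf (Submodule.subset_span (.inr ⟨j, rfl⟩))
  set p := (f (a i))⁻¹ • a i with hp
  have hphom : p.IsHomogeneous 1 := (homogeneousSubmodule σ K 1).smul_mem _ (ha i)
  let φ : MvPolynomial σ K →ₐ[K] MvPolynomial σ K := aeval (fun k => X k - f (X k) • p)
  have hφ {l : MvPolynomial σ K} (hl : l.IsHomogeneous 1) : φ l = l - f l • p :=
    aeval_X_sub_smul_of_isHomogeneous_one f p hl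
  have hφhom {l : MvPolynomial σ K} (hl : l.IsHomogeneous 1) : (φ l).IsHomogeneous 1 := by
    rw [hφ hl]
    exact hl.sub ((homogeneousSubmodule σ K 1).smul_mem _ hphom)
  have hφQ : φ Q = Q := by
    simp [hrep', hφ (ha' _), hφ (hb' _), hfa', hfb']
  have hφi : φ (a i) = 0 := by
    rw [hφ (ha i), hp, smul_smul, mul_inv_cancel₀ hfi, one_smul, sub_self]
  obtain _ | s := r
  · exact i.elim0
  refine hmin s s.lt_succ_self (fun j => φ (a (i.succAbove j))) (fun j => φ (b (i.succAbove j)))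
    (fun j => hφhom (ha _)) (fun j => hφhom (hb _)) ?_
  calc Q = φ (∑ j, a j * b j) := by rw [← hrep, hφQ]
    _ = _ := by simp [Fin.sum_univ_succAbove _ i, hφi]

/-- The span of a minimal representation of `Q` as a sum of products of linear forms is contained
in the span of any other representation of `Q`. -/
theorem span_minimal_le_span {σ ι K : Type*} [Field K] [Fintype ι] {r : ℕ}
    {Q : MvPolynomial σ K} {a b : Fin r → MvPolynomial σ K} {a' b' : ι → MvPolynomial σ K}
    (ha : ∀ i, (a i).IsHomogeneous 1) (hb : ∀ i, (b i).IsHomogeneous 1)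
    (ha' : ∀ i, (a' i).IsHomogeneous 1) (hb' : ∀ i, (b' i).IsHomogeneous 1)
    (hrep : Q = ∑ i, a i * b i) (hrep' : Q = ∑ i, a' i * b' i)
    (hmin : ∀ s : ℕ, s < r → ∀ c d : Fin s → MvPolynomial σ K,
      (∀ i, (c i).IsHomogeneous 1) → (∀ i, (d i).IsHomogeneous 1) → Q ≠ ∑ i, c i * d i) :
    Submodule.span K (Set.range a ∪ Set.range b) ≤
      Submodule.span K (Set.range a' ∪ Set.range b') := by
  rw [Submodule.span_le]
  rintro _ (⟨i, rfl⟩ | ⟨i, rfl⟩)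
  · exact left_factor_mem_span_of_minimal ha hb ha' hb' hrep hrep' hmin i
  · exact left_factor_mem_span_of_minimal hb ha ha' hb' (by simpa only [mul_comm] using hrep)
      hrep' hmin i

/-- **Uniqueness of the span of a minimal representation of an irreducible quadratic.**
If an irreducible homogeneous quadratic `Q` has `rank_s(Q) = r` (i.e. `Q` is a sum of `r`
products of linear forms but not of fewer), and
`Q = ∑ i, a i * b i = ∑ i, a' i * b' i` are two minimal representations, then the span of
the linear forms of the first representation equals that of the second. -/
theorem stmt_5 (n r : ℕ) (Q : MvPolynomial (Fin n) ℂ)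
    (hirr : Irreducible Q) (hQ : Q.IsHomogeneous 2)
    (a b a' b' : Fin r → MvPolynomial (Fin n) ℂ)
    (ha : ∀ i, (a i).IsHomogeneous 1) (hb : ∀ i, (b i).IsHomogeneous 1)
    (ha' : ∀ i, (a' i).IsHomogeneous 1) (hb' : ∀ i, (b' i).IsHomogeneous 1)
    (hrep : Q = ∑ i, a i * b i) (hrep' : Q = ∑ i, a' i * b' i)
    (hmin : ∀ s : ℕ, s < r → ∀ c d : Fin s → MvPolynomial (Fin n) ℂ,
      (∀ i, (c i).IsHomogeneous 1) → (∀ i, (d i).IsHomogeneous 1) →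
      Q ≠ ∑ i, c i * d i) :
    Submodule.span ℂ (Set.range a ∪ Set.range b) =
      Submodule.span ℂ (Set.range a' ∪ Set.range b') := by
  exact le_antisymm (span_minimal_le_span ha hb ha' hb' hrep hrep' hmin)
    (span_minimal_le_span ha' hb' ha hb hrep' hrep hmin)
end

section
/- Let Q_1', A, B be homogeneous quadratic polynomials and b_2, b homogeneous linear forms, all in the variables x_2, …, x_n (i.e., not involving x_1), and set Q_1 = x_1² + Q_1', Q_2 = x_1·b_2 − A, and Q = x_1·b + B in ℂ[x_1, …, x_n]. Assume Q vanishes at every point of ℂⁿ where both Q_1 and Q_2 vanish. Then for every point a ∈ ℂ^{n−1}, if A(a)² + b_2(a)²·Q_1'(a) = 0 then A(a)·b(a) + b_2(a)·B(a) = 0. Equivalently, the polynomial A·b + b_2·B lies in the radical of the ideal generated by A² + b_2²·Q_1' in ℂ[x_2, …, x_n]. -/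
open MvPolynomial

/-- Changing a coordinate that does not occur in `p` does not change the value of `p`. -/
theorem MvPolynomial.eval_update_of_notMem_vars {σ R : Type*} [CommSemiring R] [DecidableEq σ]
    {p : MvPolynomial σ R} {i : σ} (hi : i ∉ p.vars) (a : σ → R) (t : R) :
    eval (Function.update a i t) p = eval a p := by
  refine eval₂Hom_congr' rfl (fun j hj _ => ?_) rfl
  exact Function.update_of_ne (ne_of_mem_of_not_mem hj hi) _ _

/-- Let `Q1' , A, B` be homogeneous quadratics and `b2, b` linear forms, none involving
the variable `x_0`, and set `Q1 = x_0² + Q1'`, `Q2 = x_0·b2 − A`, `Q = x_0·b + B`.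
If `Q` vanishes on the common zero set of `Q1` and `Q2`, then at every point at which the
resultant `A² + b2²·Q1'` vanishes, `A·b + b2·B` also vanishes. -/
theorem stmt_9 (n : ℕ) (Q1' A B b2 b Q1 Q2 Q : MvPolynomial (Fin (n + 1)) ℂ)
    (hQ1' : Q1'.IsHomogeneous 2) (hA : A.IsHomogeneous 2) (hB : B.IsHomogeneous 2)
    (hb2 : b2.IsHomogeneous 1) (hb : b.IsHomogeneous 1)
    (hvQ1' : (0 : Fin (n + 1)) ∉ Q1'.vars) (hvA : (0 : Fin (n + 1)) ∉ A.vars)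
    (hvB : (0 : Fin (n + 1)) ∉ B.vars) (hvb2 : (0 : Fin (n + 1)) ∉ b2.vars)
    (hvb : (0 : Fin (n + 1)) ∉ b.vars)
    (hQ1 : Q1 = X 0 ^ 2 + Q1') (hQ2 : Q2 = X 0 * b2 - A) (hQ : Q = X 0 * b + B)
    (hvan : ∀ a : Fin (n + 1) → ℂ, eval a Q1 = 0 → eval a Q2 = 0 → eval a Q = 0) :
    ∀ a : Fin (n + 1) → ℂ,
      eval a (A ^ 2 + b2 ^ 2 * Q1') = 0 → eval a (A * b + b2 * B) = 0 := by
  intro a ha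
  simp only [map_add, map_mul, map_pow] at ha ⊢
  by_cases h : eval a b2 = 0
  · have hA0 : eval a A = 0 := by simpa [h] using ha
    simp [h, hA0]
  · have key := hvan (Function.update a 0 (eval a A / eval a b2))
    simp only [hQ1, hQ2, hQ, map_add, map_sub, map_mul, map_pow, eval_X, Function.update_self,
      eval_update_of_notMem_vars hvQ1', eval_update_of_notMem_vars hvA,
      eval_update_of_notMem_vars hvB, eval_update_of_notMem_vars hvb2,
      eval_update_of_notMem_vars hvb] at key
    have hB0 := key (by field_simp; linear_combination ha) (by field_simp; ring)
    field_simp at hB0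
    linear_combination hB0
end

section
/- Let Q_1 and Q_2 be linearly independent homogeneous quadratic polynomials in ℂ[x_1, …, x_n], and let F_1, …, F_m be quadratic polynomials such that for every i ∈ {1, …, m} there exist linear forms ℓ_i, b_i and a scalar β_i ∈ ℂ with F_i = Q_1 + ℓ_i² = β_i·Q_2 + b_i². Then there exists a ℂ-subspace V of the space of linear forms, with dim V ≤ 4, such that ℓ_i ∈ V and b_i ∈ V for every i. -/
open MvPolynomial

/-- If a product of linear forms `u * v` lies in the subalgebra generated by a space `W` of linear
forms and `v ≠ 0`, then `u ∈ W`: otherwise some linear functional vanishes on `W` but not at `u`,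
and the corresponding translation fixes the subalgebra without fixing `u * v`. -/
theorem left_mem_of_mul_mem_adjoin {σ K : Type*} [Field K] {W : Submodule K (MvPolynomial σ K)}
    (hW : W ≤ homogeneousSubmodule σ K 1) {u v : MvPolynomial σ K}
    (hu : u.IsHomogeneous 1) (hv : v.IsHomogeneous 1) (hv0 : v ≠ 0)
    (huv : u * v ∈ Algebra.adjoin K (W : Set (MvPolynomial σ K))) : u ∈ W := by
  by_contra huW
  obtain ⟨φ, hφu, hφW⟩ := Submodule.exists_le_ker_of_notMem huW
  let T : MvPolynomial σ K →ₐ[K] MvPolynomial σ K := aeval fun j => X j + C (φ (X j))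
  have hT {l : MvPolynomial σ K} (hl : l.IsHomogeneous 1) : T l = l + C (φ l) := by
    have hmem : l ∈ Submodule.span K (Set.range (X : σ → MvPolynomial σ K)) := by
      rwa [← homogeneousSubmodule_one_eq_span_X, mem_homogeneousSubmodule]
    induction hmem using Submodule.span_induction with
    | mem x hx =>
      obtain ⟨j, rfl⟩ := hx
      simp [T]
    | zero => simp
    | add x y hxs hys hx hy =>
      rw [← homogeneousSubmodule_one_eq_span_X] at hxs hys
      rw [map_add, hx hxs, hy hys, map_add, C_add]
      ring
    | smul a x hxs hx =>
      rw [← homogeneousSubmodule_one_eq_span_X] at hxs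
      rw [map_smul, hx hxs, map_smul, smul_add, smul_eq_mul, C_mul, smul_eq_C_mul, smul_eq_C_mul]
  have hfix : T (u * v) = u * v := by
    have hle : Algebra.adjoin K (W : Set (MvPolynomial σ K)) ≤ AlgHom.equalizer T (AlgHom.id K _) :=
      Algebra.adjoin_le fun w hw => by
        have hw0 : φ w = 0 := hφW hw
        simpa [AlgHom.mem_equalizer, hw0] using hT (hW hw)
    exact hle huv
  rw [map_mul, hT hu, hT hv] at hfix
  have hrel : C (φ u) * v + C (φ v) * u + C (φ u * φ v) = 0 := by
    rw [C_mul]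
    linear_combination hfix
  have hconst := congrArg constantCoeff hrel
  have hu1 : constantCoeff u = 0 := hu.coeff_eq_zero (by simp)
  have hv1 : constantCoeff v = 0 := hv.coeff_eq_zero (by simp)
  have hφv : φ v = 0 := by simpa [hu1, hv1, hφu] using hconst
  simp [hφv, hφu, hv0] at hrel

/-- If `Q1, Q2` are linearly independent homogeneous quadratics and each quadratic `F i`
satisfies `F i = Q1 + (ℓ i)² = β i • Q2 + (b i)²` for linear forms `ℓ i, b i`, then all
the `ℓ i` and `b i` lie in a subspace of linear forms of dimension at most `4`. -/
theorem stmt_11 (n m : ℕ) (Q1 Q2 : MvPolynomial (Fin n) ℂ)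
    (hQ1 : Q1.IsHomogeneous 2) (hQ2 : Q2.IsHomogeneous 2)
    (hind : LinearIndependent ℂ ![Q1, Q2])
    (F ℓ b : Fin m → MvPolynomial (Fin n) ℂ) (β : Fin m → ℂ)
    (hF : ∀ i, (F i).IsHomogeneous 2)
    (hℓ : ∀ i, (ℓ i).IsHomogeneous 1) (hb : ∀ i, (b i).IsHomogeneous 1)
    (hrep1 : ∀ i, F i = Q1 + ℓ i ^ 2) (hrep2 : ∀ i, F i = β i • Q2 + b i ^ 2) :
    ∃ V : Submodule ℂ (MvPolynomial (Fin n) ℂ),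
      V ≤ homogeneousSubmodule (Fin n) ℂ 1 ∧ Module.finrank ℂ ↥V ≤ 4 ∧
      ∀ i, ℓ i ∈ V ∧ b i ∈ V := by
  have mem_of_sub_mem {W : Submodule ℂ (MvPolynomial (Fin n) ℂ)}
      (hW : W ≤ homogeneousSubmodule (Fin n) ℂ 1)
      (hQ : ∀ i, Q1 - β i • Q2 ∈ Algebra.adjoin ℂ (W : Set (MvPolynomial (Fin n) ℂ))) (i : Fin m) :
      ℓ i ∈ W ∧ b i ∈ W := by
    have hprod : (b i - ℓ i) * (b i + ℓ i) = Q1 - β i • Q2 := by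
      linear_combination hrep1 i - hrep2 i
    have hne : Q1 - β i • Q2 ≠ 0 := fun h => by
      have h1 := LinearIndependent.pair_iff.mp hind 1 (-β i) (by rw [← h]; module)
      exact one_ne_zero h1.1
    have hsub : (b i - ℓ i).IsHomogeneous 1 := (hb i).sub (hℓ i)
    have hadd : (b i + ℓ i).IsHomogeneous 1 := (hb i).add (hℓ i)
    rw [← hprod] at hne
    have hmem := hQ i
    rw [← hprod] at hmem
    have h1 : b i - ℓ i ∈ W :=
      left_mem_of_mul_mem_adjoin hW hsub hadd (right_ne_zero_of_mul hne) hmem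
    have h2 : b i + ℓ i ∈ W :=
      left_mem_of_mul_mem_adjoin hW hadd hsub (left_ne_zero_of_mul hne) (by rwa [mul_comm])
    constructor
    · convert W.smul_mem (1 / 2 : ℂ) (W.sub_mem h2 h1) using 1
      module
    · convert W.smul_mem (1 / 2 : ℂ) (W.add_mem h2 h1) using 1
      module
  obtain hm | ⟨⟨i⟩⟩ := isEmpty_or_nonempty (Fin m)
  · exact ⟨⊥, bot_le, by simp, fun i => hm.elim i⟩
  obtain ⟨j, hj⟩ : ∃ j, (∀ k, β k = β i) ∨ β j ≠ β i := by
    by_cases h : ∀ k, β k = β i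
    · exact ⟨i, .inl h⟩
    · push Not at h
      exact h.imp fun _ => .inr
  let W := Submodule.span ℂ (Set.range ![ℓ i, b i, ℓ j, b j])
  have hW : W ≤ homogeneousSubmodule (Fin n) ℂ 1 := by
    rw [Submodule.span_le]
    rintro _ ⟨k, rfl⟩
    fin_cases k
    exacts [hℓ i, hb i, hℓ j, hb j]
  have hgen (k : Fin 4) : ![ℓ i, b i, ℓ j, b j] k ∈
      Algebra.adjoin ℂ (W : Set (MvPolynomial (Fin n) ℂ)) :=
    Algebra.subset_adjoin (Submodule.subset_span ⟨k, rfl⟩)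
  have hQi : Q1 - β i • Q2 ∈ Algebra.adjoin ℂ (W : Set (MvPolynomial (Fin n) ℂ)) := by
    convert sub_mem (pow_mem (hgen 1) 2) (pow_mem (hgen 0) 2) using 1
    simp only [Matrix.cons_val]
    linear_combination hrep2 i - hrep1 i
  have hQj : Q1 - β j • Q2 ∈ Algebra.adjoin ℂ (W : Set (MvPolynomial (Fin n) ℂ)) := by
    convert sub_mem (pow_mem (hgen 3) 2) (pow_mem (hgen 2) 2) using 1
    simp only [Matrix.cons_val]
    linear_combination hrep2 j - hrep1 j
  refine ⟨W, hW, (finrank_range_le_card _).trans_eq (Fintype.card_fin 4),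
    mem_of_sub_mem hW fun k => ?_⟩
  obtain hall | hne := hj
  · rwa [hall k]
  · have hsub : β j - β i ≠ 0 := sub_ne_zero.mpr hne
    have hQ2W : Q2 ∈ Algebra.adjoin ℂ (W : Set (MvPolynomial (Fin n) ℂ)) := by
      convert Subalgebra.smul_mem _ (sub_mem hQi hQj) (β j - β i)⁻¹ using 1
      rw [sub_sub_sub_cancel_left, ← sub_smul, inv_smul_smul₀ hsub]
    convert sub_mem hQi (Subalgebra.smul_mem _ hQ2W (β k - β i)) using 1
    module
end

section
/- Let Q_1 and Q_2 be linearly independent homogeneous quadratic polynomials in ℂ[x_1, …, x_n], and let F_1, …, F_m be quadratic polynomials such that for every i ∈ {1, …, m} there exist linear forms ℓ_i, b_i and a scalar β_i ∈ ℂ with F_i = Q_1 + ℓ_i² = β_i·Q_2 + b_i². Then there exist four linear forms a_1, a_2, a_3, a_4 such that every F_i lies in the ℂ-linear span of the set {Q_1} ∪ {a_j·a_k : 1 ≤ j ≤ k ≤ 4}. -/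
open MvPolynomial

section LinearForms

variable {n : ℕ}

/-- A homogeneous polynomial of degree one is a linear combination of the variables. -/
lemma exists_coeffs_of_isHomogeneous_one {p : MvPolynomial (Fin n) ℂ}
    (hp : p.IsHomogeneous 1) : ∃ c : Fin n → ℂ, p = ∑ j, c j • X j := by
  have h : p ∈ Submodule.span ℂ (Set.range (X : Fin n → MvPolynomial (Fin n) ℂ)) := by
    rw [← homogeneousSubmodule_one_eq_span_X]
    exact hp
  obtain ⟨c, hc⟩ := (Submodule.mem_span_range_iff_exists_fun ℂ).1 h
  exact ⟨c, hc.symm⟩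

/-- The derivative of a linear form in the direction `d`. -/
lemma mkDerivation_linear (c d : Fin n → ℂ) :
    mkDerivation ℂ (fun j => (C (d j) : MvPolynomial (Fin n) ℂ)) (∑ j, c j • X j) =
      C (c ⬝ᵥ d) := by
  simp [map_sum, mkDerivation_X, dotProduct, smul_eq_C_mul]

/-- A linear form killed by every direction that kills all the `a i` is in their span. -/
lemma mem_span_of_mkDerivation_eq_zero {ι : Type*} [Finite ι]
    {a : ι → MvPolynomial (Fin n) ℂ} (ha : ∀ i, (a i).IsHomogeneous 1)
    {u : MvPolynomial (Fin n) ℂ} (hu : u.IsHomogeneous 1)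
    (h : ∀ d : Fin n → ℂ,
      (∀ i, mkDerivation ℂ (fun j => (C (d j) : MvPolynomial (Fin n) ℂ)) (a i) = 0) →
      mkDerivation ℂ (fun j => (C (d j) : MvPolynomial (Fin n) ℂ)) u = 0) :
    u ∈ Submodule.span ℂ (Set.range a) := by
  have := Fintype.ofFinite ι
  choose c hc using fun i => exists_coeffs_of_isHomogeneous_one (ha i)
  obtain ⟨e, rfl⟩ := exists_coeffs_of_isHomogeneous_one hu
  have key : dotProductBilin ℂ ℂ e ∈
      Submodule.span ℂ (Set.range fun i => dotProductBilin ℂ ℂ (c i)) := by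
    apply mem_span_of_iInf_ker_le_ker
    intro d hd
    simp only [Submodule.mem_iInf, LinearMap.mem_ker, dotProductBilin_apply_apply] at hd ⊢
    have := h d fun i => by rw [hc, mkDerivation_linear, hd, C_0]
    rwa [mkDerivation_linear, C_eq_zero] at this
  obtain ⟨r, hr⟩ := (Submodule.mem_span_range_iff_exists_fun ℂ).1 key
  refine (Submodule.mem_span_range_iff_exists_fun ℂ).2 ⟨r, ?_⟩
  have he : ∀ j, e j = ∑ i, r i * c i j := fun j => by
    simpa using (LinearMap.congr_fun hr (Pi.single j 1)).symm
  simp only [hc, he, Finset.smul_sum, Finset.sum_smul, smul_smul]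
  exact Finset.sum_comm

/-- If a nonzero product of two linear forms has zero derivative in some direction, then so
does its first factor. -/
lemma mkDerivation_eq_zero_of_mul {u w : MvPolynomial (Fin n) ℂ}
    (hu : u.IsHomogeneous 1) (hw : w.IsHomogeneous 1) (huw : u * w ≠ 0) {d : Fin n → ℂ}
    (h : mkDerivation ℂ (fun j => (C (d j) : MvPolynomial (Fin n) ℂ)) (u * w) = 0) :
    mkDerivation ℂ (fun j => (C (d j) : MvPolynomial (Fin n) ℂ)) u = 0 := by
  obtain ⟨c, hc⟩ := exists_coeffs_of_isHomogeneous_one hu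
  obtain ⟨e, he⟩ := exists_coeffs_of_isHomogeneous_one hw
  have hDu := mkDerivation_linear c d
  have hDw := mkDerivation_linear e d
  rw [← hc] at hDu
  rw [← he] at hDw
  have h2 := congrArg (mkDerivation ℂ (fun j => (C (d j) : MvPolynomial (Fin n) ℂ))) h
  simp only [Derivation.leibniz, map_add, hDu, hDw, smul_eq_mul, derivation_C, mul_zero,
    zero_add, map_zero] at h h2
  rw [hDu]
  by_contra hne
  have hw0 : (C (e ⬝ᵥ d) : MvPolynomial (Fin n) ℂ) = 0 := by
    have h3 : (2 : MvPolynomial (Fin n) ℂ) * (C (c ⬝ᵥ d) * C (e ⬝ᵥ d)) = 0 := by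
      linear_combination h2
    simpa [hne] using h3
  rw [hw0, mul_zero, zero_add] at h
  exact huw (by simp [(mul_eq_zero.1 h).resolve_right hne])

/-- The square of an element of the span of `a` is in the span of the products `a j * a k`. -/
lemma sq_mem_span_mul {N : ℕ} {a : Fin N → MvPolynomial (Fin n) ℂ}
    {u : MvPolynomial (Fin n) ℂ} (hu : u ∈ Submodule.span ℂ (Set.range a)) :
    u ^ 2 ∈ Submodule.span ℂ {x | ∃ j k : Fin N, j ≤ k ∧ x = a j * a k} := by
  have h := Submodule.mul_mem_mul hu hu
  rw [Submodule.span_mul_span, ← sq] at h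
  refine Submodule.span_mono ?_ h
  rintro _ ⟨_, ⟨j, rfl⟩, _, ⟨k, rfl⟩, rfl⟩
  rcases le_total j k with hjk | hjk
  · exact ⟨j, k, hjk, rfl⟩
  · exact ⟨k, j, hjk, mul_comm _ _⟩

end LinearForms

/-- If `Q1, Q2` are linearly independent homogeneous quadratics and each quadratic `F i`
satisfies `F i = Q1 + (ℓ i)² = β i • Q2 + (b i)²` for linear forms `ℓ i, b i`, then there
exist four linear forms `a 0, a 1, a 2, a 3` such that every `F i` lies in the linear span
of `{Q1} ∪ {a j * a k : j ≤ k}`. -/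
theorem stmt_12 (n m : ℕ) (Q1 Q2 : MvPolynomial (Fin n) ℂ)
    (hQ1 : Q1.IsHomogeneous 2) (hQ2 : Q2.IsHomogeneous 2)
    (hind : LinearIndependent ℂ ![Q1, Q2])
    (F ℓ b : Fin m → MvPolynomial (Fin n) ℂ) (β : Fin m → ℂ)
    (hF : ∀ i, (F i).IsHomogeneous 2)
    (hℓ : ∀ i, (ℓ i).IsHomogeneous 1) (hb : ∀ i, (b i).IsHomogeneous 1)
    (hrep1 : ∀ i, F i = Q1 + ℓ i ^ 2) (hrep2 : ∀ i, F i = β i • Q2 + b i ^ 2) :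
    ∃ a : Fin 4 → MvPolynomial (Fin n) ℂ,
      (∀ j, (a j).IsHomogeneous 1) ∧
      ∀ i, F i ∈ Submodule.span ℂ
        ({Q1} ∪ {x | ∃ j k : Fin 4, j ≤ k ∧ x = a j * a k} :
          Set (MvPolynomial (Fin n) ℂ)) := by
  have hR : ∀ i, b i ^ 2 - ℓ i ^ 2 = Q1 - β i • Q2 := fun i => by
    linear_combination hrep1 i - hrep2 i
  have hR0 : ∀ i, Q1 - β i • Q2 ≠ 0 := fun i h => by
    have := LinearIndependent.pair_iff.1 hind 1 (-β i) (by rw [← h]; module)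
    exact one_ne_zero this.1
  rcases isEmpty_or_nonempty (Fin m) with hm | ⟨⟨i₀⟩⟩
  · exact ⟨0, fun _ => isHomogeneous_zero _ _ _, fun i => hm.elim i⟩
  have hpencil : ∃ i₁ i₂, ∀ i, ∃ s t : ℂ,
      Q1 - β i • Q2 = s • (Q1 - β i₁ • Q2) + t • (Q1 - β i₂ • Q2) := by
    by_cases h : ∃ i₁, β i₁ ≠ β i₀
    · obtain ⟨i₁, h₁⟩ := h
      have h₁' := sub_ne_zero.2 h₁
      refine ⟨i₁, i₀, fun i => ⟨(β i - β i₀) / (β i₁ - β i₀),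
        (β i₁ - β i) / (β i₁ - β i₀), ?_⟩⟩
      match_scalars <;> field_simp <;> ring
    · push Not at h
      exact ⟨i₀, i₀, fun i => ⟨1, 0, by rw [h i]; module⟩⟩
  obtain ⟨i₁, i₂, hpencil⟩ := hpencil
  have ha : ∀ j, (![b i₁, ℓ i₁, b i₂, ℓ i₂] j).IsHomogeneous 1 := by
    intro j
    fin_cases j
    exacts [hb i₁, hℓ i₁, hb i₂, hℓ i₂]
  refine ⟨![b i₁, ℓ i₁, b i₂, ℓ i₂], ha, fun i => ?_⟩
  have hu : (b i - ℓ i).IsHomogeneous 1 := (hb i).sub (hℓ i)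
  have hw : (b i + ℓ i).IsHomogeneous 1 := (hb i).add (hℓ i)
  have hprod : (b i - ℓ i) * (b i + ℓ i) = Q1 - β i • Q2 := by rw [← hR i]; ring
  have hD : ∀ d : Fin n → ℂ,
      (∀ j, mkDerivation ℂ (fun k => (C (d k) : MvPolynomial (Fin n) ℂ))
        (![b i₁, ℓ i₁, b i₂, ℓ i₂] j) = 0) →
      mkDerivation ℂ (fun k => (C (d k) : MvPolynomial (Fin n) ℂ)) (Q1 - β i • Q2) = 0 := by
    intro d hd
    obtain ⟨s, t, hst⟩ := hpencil i
    have h0 := hd 0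
    have h1 := hd 1
    have h2 := hd 2
    have h3 := hd 3
    simp only [Matrix.cons_val] at h0 h1 h2 h3
    rw [hst, ← hR i₁, ← hR i₂]
    simp [sq, h0, h1, h2, h3]
  have hu_mem := mem_span_of_mkDerivation_eq_zero ha hu fun d hd =>
    mkDerivation_eq_zero_of_mul hu hw (hprod ▸ hR0 i) (hprod ▸ hD d hd)
  have hw_mem := mem_span_of_mkDerivation_eq_zero ha hw fun d hd =>
    mkDerivation_eq_zero_of_mul hw hu (mul_comm (b i - ℓ i) _ ▸ hprod ▸ hR0 i)
      (mul_comm (b i - ℓ i) _ ▸ hprod ▸ hD d hd)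
  have hℓ_mem : ℓ i ∈ Submodule.span ℂ (Set.range ![b i₁, ℓ i₁, b i₂, ℓ i₂]) := by
    have : ℓ i = (1 / 2 : ℂ) • ((b i + ℓ i) - (b i - ℓ i)) := by module
    rw [this]
    exact Submodule.smul_mem _ _ (Submodule.sub_mem _ hw_mem hu_mem)
  rw [hrep1 i]
  exact Submodule.add_mem _ (Submodule.subset_span (Or.inl rfl))
    (Submodule.span_mono Set.subset_union_right (sq_mem_span_mul hℓ_mem))
end
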